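/- Let P be a simple polygon in the plane with vertices v_0, …, v_{n-1} in counterclockwise order (indices mod n), with no three distinct vertices collinear. Let i be an index and j = i + k (mod n) with 2 ≤ k ≤ n − 1. Let t* be the largest t ∈ {1, …, k − 1} such that v_{i+t} is visible to v_i (t* exists since v_{i+1} is visible to v_i), and set v' = v_{i+t*}, i.e., v' is the last vertex of the chain ch(v_{i+1}, v_{j-1}) that is visible to v_i. Then v_i is visible to v_j if and only if v' is a triangle witness for (v_i, v_j), i.e., if and only if v' is visible to v_j and the solid triangle conv{v_i, v', v_j} is contained in P. -/

import Mathlib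

/-- A point in the Euclidean plane. -/
abbrev Plane := ℝ × ℝ

/-- A simple polygon with `n` vertices `v 0, …, v (n-1)` in counterclockwise order
(indices mod `n`), given as a compact region `P` of the plane that is the closure of its
interior, whose frontier is the union of the closed edge segments `[v i, v (i+1)]`,
such that consecutive edges meet exactly in their common endpoint and non-consecutive
edges are disjoint; moreover no three distinct vertices are collinear. -/
structure SimplePolygon (n : ℕ) where
  three_le : 3 ≤ n
  v : ZMod n → Plane
  inj : Function.Injective v
  P : Set Plane
  compact : IsCompact P
  regular : P = closure (interior P)
  frontier_eq : frontier P = ⋃ i : ZMod n, segment ℝ (v i) (v (i + 1))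
  edges_consecutive : ∀ i : ZMod n,
    segment ℝ (v i) (v (i + 1)) ∩ segment ℝ (v (i + 1)) (v (i + 1 + 1)) = {v (i + 1)}
  edges_disjoint : ∀ i j : ZMod n, i ≠ j → j ≠ i + 1 → i ≠ j + 1 →
    Disjoint (segment ℝ (v i) (v (i + 1))) (segment ℝ (v j) (v (j + 1)))
  no_three_collinear : ∀ a b c : ZMod n, a ≠ b → a ≠ c → b ≠ c →
    ¬ Collinear ℝ ({v a, v b, v c} : Set Plane)

/-- `a` is visible to `b` in `P`: the closed segment `[a, b]` is contained in `P`. -/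
def Visible (P : Set Plane) (a b : Plane) : Prop := segment ℝ a b ⊆ P

/-- Affine coordinates `a`, `b` of the plane in which `O`, `A`, `B` are `(0, 0)`, `(1, 0)`,
`(0, 1)`. -/
structure AffCoords (O A B : Plane) where
  a : Plane →ᵃ[ℝ] ℝ
  b : Plane →ᵃ[ℝ] ℝ
  a_O : a O = 0
  a_A : a A = 1
  a_B : a B = 0
  b_O : b O = 0
  b_A : b A = 0
  b_B : b B = 1
  eq : ∀ x, x = O + (a x • (A - O) + b x • (B - O))
  cross_ne : (A.1 - O.1) * (B.2 - O.2) - (A.2 - O.2) * (B.1 - O.1) ≠ 0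

theorem cross_ne_zero_of_not_collinear {O A B : Plane} (h : ¬ Collinear ℝ ({O, A, B} : Set Plane)) :
    (A.1 - O.1) * (B.2 - O.2) - (A.2 - O.2) * (B.1 - O.1) ≠ 0 := by
  intro h0
  apply h
  by_cases hA : A = O
  · subst hA
    simpa using collinear_pair ℝ A B
  rw [collinear_iff_of_mem (p₀ := O) (by simp)]
  refine ⟨A - O, ?_⟩
  have hne : A.1 - O.1 ≠ 0 ∨ A.2 - O.2 ≠ 0 := by
    by_contra hc
    push Not at hc
    exact hA (Prod.ext (by linarith [hc.1]) (by linarith [hc.2]))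
  intro p hp
  simp only [Set.mem_insert_iff, Set.mem_singleton_iff] at hp
  rcases hp with rfl | rfl | rfl
  · exact ⟨0, by simp⟩
  · exact ⟨1, by simp⟩
  · rcases hne with hne | hne
    · refine ⟨(p.1 - O.1) / (A.1 - O.1), Prod.ext ?_ ?_⟩ <;> simp <;> field_simp <;> linarith
    · refine ⟨(p.2 - O.2) / (A.2 - O.2), Prod.ext ?_ ?_⟩ <;> simp <;> field_simp <;> linarith

theorem exists_affCoords {O A B : Plane} (h : ¬ Collinear ℝ ({O, A, B} : Set Plane)) :
    Nonempty (AffCoords O A B) := by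
  have hD := cross_ne_zero_of_not_collinear h
  set D := (A.1 - O.1) * (B.2 - O.2) - (A.2 - O.2) * (B.1 - O.1) with hDdef
  let f : Plane →ₗ[ℝ] ℝ :=
    ((B.2 - O.2) / D) • LinearMap.fst ℝ ℝ ℝ - ((B.1 - O.1) / D) • LinearMap.snd ℝ ℝ ℝ
  let g : Plane →ₗ[ℝ] ℝ :=
    ((A.1 - O.1) / D) • LinearMap.snd ℝ ℝ ℝ - ((A.2 - O.2) / D) • LinearMap.fst ℝ ℝ ℝ
  refine ⟨⟨f.toAffineMap - AffineMap.const ℝ Plane (f O),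
    g.toAffineMap - AffineMap.const ℝ Plane (g O), ?_, ?_, ?_, ?_, ?_, ?_, ?_,
    hD⟩⟩
  · simp
  · simp [f]; field_simp; rw [hDdef]; ring
  · simp [f]; field_simp; ring
  · simp
  · simp [g]; field_simp; ring
  · simp [g]; field_simp; rw [hDdef]; ring
  · intro x
    refine Prod.ext ?_ ?_ <;> simp [f, g] <;> field_simp <;> rw [hDdef] <;> ring

/-- The signed angle at `x` from `p` to `q`. -/
noncomputable def viewAngle (p q x : Plane) : ℝ :=
  Complex.arg ((⟨q.1 - x.1, q.2 - x.2⟩ : ℂ) / ⟨p.1 - x.1, p.2 - x.2⟩)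

theorem isClosed_segment (p q : Plane) : IsClosed (segment ℝ p q) := by
  rw [← closure_openSegment]
  exact isClosed_closure

theorem complex_mk_sub_ne_zero {p x : Plane} (h : x ≠ p) :
    (⟨p.1 - x.1, p.2 - x.2⟩ : ℂ) ≠ 0 := by
  intro h0
  have h1 := congrArg Complex.re h0
  have h2 := congrArg Complex.im h0
  simp only [Complex.zero_re, Complex.zero_im] at h1 h2
  exact h (Prod.ext (by linarith) (by linarith))

theorem viewAngle_quotient_mem_slitPlane {p q x : Plane} (h : x ∉ segment ℝ p q) :
    ((⟨q.1 - x.1, q.2 - x.2⟩ : ℂ) / ⟨p.1 - x.1, p.2 - x.2⟩) ∈ Complex.slitPlane := by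
  have hxp : x ≠ p := fun e => h (e ▸ left_mem_segment ℝ p q)
  have hp := complex_mk_sub_ne_zero hxp
  by_contra hc
  rw [Complex.mem_slitPlane_iff] at hc
  push Not at hc
  obtain ⟨h1, h2⟩ := hc
  set z : ℂ := (⟨q.1 - x.1, q.2 - x.2⟩ : ℂ) / ⟨p.1 - x.1, p.2 - x.2⟩ with hz
  have hm : z * ⟨p.1 - x.1, p.2 - x.2⟩ = (⟨q.1 - x.1, q.2 - x.2⟩ : ℂ) := by
    rw [hz]; field_simp
  have e1 := congrArg Complex.re hm
  have e2 := congrArg Complex.im hm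
  simp only [Complex.mul_re, Complex.mul_im, h2] at e1 e2
  apply h
  have hs : 0 < 1 - z.re := by linarith
  refine ⟨(-z.re) / (1 - z.re), 1 / (1 - z.re), by apply div_nonneg <;> linarith, by positivity,
    by field_simp; ring, Prod.ext ?_ ?_⟩ <;> simp <;> field_simp <;> linarith

theorem continuousAt_viewAngle {p q x : Plane} (h : x ∉ segment ℝ p q) :
    ContinuousAt (viewAngle p q) x := by
  have hxp : x ≠ p := fun e => h (e ▸ left_mem_segment ℝ p q)
  have hc : ∀ r : Plane, Continuous fun y : Plane => (⟨r.1 - y.1, r.2 - y.2⟩ : ℂ) := fun r =>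
    Complex.equivRealProdCLM.symm.continuous.comp (f := fun y : Plane => (r.1 - y.1, r.2 - y.2))
      (by fun_prop)
  have h1 : ContinuousAt
      (fun y : Plane => (⟨q.1 - y.1, q.2 - y.2⟩ : ℂ) / ⟨p.1 - y.1, p.2 - y.2⟩) x :=
    (hc q).continuousAt.div (hc p).continuousAt (complex_mk_sub_ne_zero hxp)
  exact ContinuousAt.comp (g := Complex.arg)
    (Complex.continuousAt_arg (viewAngle_quotient_mem_slitPlane h)) h1

/-- The total angle at `x` along the closed polygon `O, u l, …, u k, O`. -/
noncomputable def totalAngle (u : ℕ → Plane) (O : Plane) (l k : ℕ) (x : Plane) : ℝ :=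
  viewAngle O (u l) x + ∑ j ∈ Finset.Ico l k, viewAngle (u j) (u (j + 1)) x
    + viewAngle (u k) O x

/-- The points of the closed polygon `O, u l, …, u k, O`. -/
def closedChain (u : ℕ → Plane) (O : Plane) (l k : ℕ) : Set Plane :=
  {x | x ∈ segment ℝ O (u l) ∨ x ∈ segment ℝ O (u k) ∨
    ∃ j, l ≤ j ∧ j < k ∧ x ∈ segment ℝ (u j) (u (j + 1))}

theorem continuousAt_totalAngle {u : ℕ → Plane} {O : Plane} {l k : ℕ} {x : Plane}
    (h : x ∉ closedChain u O l k) : ContinuousAt (totalAngle u O l k) x := by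
  simp only [closedChain, Set.mem_ofPred_eq, not_or, not_exists, not_and] at h
  unfold totalAngle
  refine ContinuousAt.add (ContinuousAt.add (continuousAt_viewAngle h.1) ?_)
    (continuousAt_viewAngle (by rw [segment_symm]; exact h.2.1))
  refine tendsto_finsetSum _ fun j hj => ?_
  rw [Finset.mem_Ico] at hj
  exact continuousAt_viewAngle (h.2.2 j hj.1 hj.2)

theorem totalAngle_mem_range {u : ℕ → Plane} {O : Plane} {l k : ℕ} (hlk : l < k) {x : Plane}
    (h : x ∉ closedChain u O l k) : ∃ m : ℤ, totalAngle u O l k x = m * (2 * Real.pi) := by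
  simp only [closedChain, Set.mem_ofPred_eq, not_or, not_exists, not_and] at h
  obtain ⟨h1, h2, h3⟩ := h
  let c : Plane → ℂ := fun p => ⟨p.1 - x.1, p.2 - x.2⟩
  have hO : c O ≠ 0 := complex_mk_sub_ne_zero fun e => h1 (e ▸ left_mem_segment ℝ _ _)
  have hl : c (u l) ≠ 0 := complex_mk_sub_ne_zero fun e => h1 (e ▸ right_mem_segment ℝ _ _)
  have hk : c (u k) ≠ 0 := complex_mk_sub_ne_zero fun e => h2 (e ▸ right_mem_segment ℝ _ _)
  have hu : ∀ j, l ≤ j → j < k → c (u j) ≠ 0 := fun j hj hj' =>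
    complex_mk_sub_ne_zero fun e => h3 j hj hj' (e ▸ left_mem_segment ℝ _ _)
  have hprod : ∀ m, l ≤ m → m ≤ k →
      Complex.exp (∑ j ∈ Finset.Ico l m, Complex.log (c (u (j + 1)) / c (u j)))
        = c (u m) / c (u l) := by
    intro m hm
    induction m, hm using Nat.le_induction with
    | base => intro _; simp [hl]
    | succ m hm ih =>
      intro hmk
      have hm0 := hu m hm (by omega)
      have hm1 : c (u (m + 1)) ≠ 0 := by
        rcases (by omega : m + 1 < k ∨ m + 1 = k) with h | h
        · exact hu _ (by omega) h
        · rw [h]; exact hk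
      rw [Finset.sum_Ico_succ_top hm, Complex.exp_add, ih (by omega),
        Complex.exp_log (div_ne_zero hm1 hm0)]
      field_simp
  have hexp : Complex.exp (Complex.log (c (u l) / c O)
      + ∑ j ∈ Finset.Ico l k, Complex.log (c (u (j + 1)) / c (u j))
      + Complex.log (c O / c (u k))) = 1 := by
    rw [Complex.exp_add, Complex.exp_add, hprod k hlk.le le_rfl,
      Complex.exp_log (div_ne_zero hl hO), Complex.exp_log (div_ne_zero hO hk)]
    field_simp
  obtain ⟨m, hm⟩ := Complex.exp_eq_one_iff.1 hexp
  refine ⟨m, ?_⟩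
  have := congrArg Complex.im hm
  simpa [Complex.log_im, totalAngle, viewAngle, c] using this

theorem IsPreconnected.totalAngle_eq {u : ℕ → Plane} {O : Plane} {l k : ℕ} (hlk : l < k)
    {s : Set Plane} (hs : IsPreconnected s) (hd : ∀ x ∈ s, x ∉ closedChain u O l k)
    {x y : Plane} (hx : x ∈ s) (hy : y ∈ s) :
    totalAngle u O l k x = totalAngle u O l k y := by
  have key : totalAngle u O l k x / (2 * Real.pi) = totalAngle u O l k y / (2 * Real.pi) := by
    refine hs.constant_of_mapsTo (T := Set.range ((↑) : ℤ → ℝ))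
      (f := fun z => totalAngle u O l k z / (2 * Real.pi)) ?_ ?_ ?_ hx hy
    · exact ⟨Int.isClosedEmbedding_coe_real.isEmbedding.toHomeomorph.symm.isEmbedding.discreteTopology⟩
    · exact fun z hz => ((continuousAt_totalAngle (hd z hz)).div_const _).continuousWithinAt
    · intro z hz
      obtain ⟨m, hm⟩ := totalAngle_mem_range hlk (hd z hz)
      refine ⟨m, ?_⟩
      simp only [hm]
      have := Real.pi_ne_zero
      field_simp
  have := Real.pi_ne_zero
  field_simp at key
  exact key

theorem viewAngle_gt {p q x : Plane}
    (hre : (q.1 - x.1) * (p.1 - x.1) + (q.2 - x.2) * (p.2 - x.2) < 0)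
    (him : 0 < (q.2 - x.2) * (p.1 - x.1) - (q.1 - x.1) * (p.2 - x.2)) :
    Real.pi / 2 < viewAngle p q x := by
  have hp : (⟨p.1 - x.1, p.2 - x.2⟩ : ℂ) ≠ 0 := complex_mk_sub_ne_zero fun e => by
    subst e; simp at hre
  have hn := Complex.normSq_pos.2 hp
  have h1 : ¬ |viewAngle p q x| ≤ Real.pi / 2 := by
    rw [viewAngle, Complex.abs_arg_le_pi_div_two_iff, Complex.div_re, ← add_div, not_le]
    exact div_neg_of_neg_of_pos hre hn
  have h2 : 0 ≤ viewAngle p q x := by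
    rw [viewAngle, Complex.arg_nonneg_iff, Complex.div_im, ← sub_div]
    exact (div_pos him hn).le
  rwa [abs_of_nonneg h2, not_le] at h1

theorem viewAngle_lt {p q x : Plane}
    (hre : (q.1 - x.1) * (p.1 - x.1) + (q.2 - x.2) * (p.2 - x.2) < 0)
    (him : (q.2 - x.2) * (p.1 - x.1) - (q.1 - x.1) * (p.2 - x.2) < 0) :
    viewAngle p q x < -(Real.pi / 2) := by
  have hp : (⟨p.1 - x.1, p.2 - x.2⟩ : ℂ) ≠ 0 := complex_mk_sub_ne_zero fun e => by
    subst e; simp at hre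
  have hn := Complex.normSq_pos.2 hp
  have h1 : ¬ |viewAngle p q x| ≤ Real.pi / 2 := by
    rw [viewAngle, Complex.abs_arg_le_pi_div_two_iff, Complex.div_re, ← add_div, not_le]
    exact div_neg_of_neg_of_pos hre hn
  have h2 : viewAngle p q x < 0 := by
    rw [viewAngle, Complex.arg_neg_iff, Complex.div_im, ← sub_div]
    exact div_neg_of_neg_of_pos him hn
  rw [abs_of_neg h2, not_le] at h1
  linarith

/-- The angle under which a segment is seen jumps when the segment is crossed. -/
theorem eventually_viewAngle_jump {p q x w : Plane} {R : Plane → ℝ} (hx : x ∈ openSegment ℝ p q)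
    (hR : ContinuousAt R x)
    (hw : (q.1 - p.1) * w.2 - (q.2 - p.2) * w.1 ≠ 0) :
    ∀ᶠ t in nhdsWithin (0 : ℝ) (Set.Ioi 0),
      viewAngle p q (x + t • w) + R (x + t • w) ≠ viewAngle p q (x - t • w) + R (x - t • w) := by
  obtain ⟨a, b, ha, hb, hab, rfl⟩ := hx
  have hd : 0 < (q.1 - p.1) ^ 2 + (q.2 - p.2) ^ 2 := by
    by_contra hc
    have h1 : q.1 - p.1 = 0 := by nlinarith [sq_nonneg (q.1 - p.1), sq_nonneg (q.2 - p.2)]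
    have h2 : q.2 - p.2 = 0 := by nlinarith [sq_nonneg (q.1 - p.1), sq_nonneg (q.2 - p.2)]
    simp [h1, h2] at hw
  obtain rfl : a = 1 - b := by linarith
  set x : Plane := (1 - b) • p + b • q with hxdef
  have hx1 : x.1 = (1 - b) * p.1 + b * q.1 := by simp [hxdef]
  have hx2 : x.2 = (1 - b) * p.2 + b * q.2 := by simp [hxdef]
  have hcont : ∀ s : ℝ, Filter.Tendsto (fun t : ℝ => x + (s * t) • w) (nhds 0) (nhds x) := by
    intro s
    have : Continuous fun t : ℝ => x + (s * t) • w := by fun_prop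
    simpa using this.tendsto 0
  have hRe : ∀ᶠ y in nhds x, (q.1 - y.1) * (p.1 - y.1) + (q.2 - y.2) * (p.2 - y.2) < 0 := by
    have hc : Continuous fun y : Plane =>
      (q.1 - y.1) * (p.1 - y.1) + (q.2 - y.2) * (p.2 - y.2) := by fun_prop
    refine hc.continuousAt.eventually_lt continuousAt_const ?_
    rw [hx1, hx2]
    nlinarith [mul_pos (mul_pos ha hb) hd]
  have hRR : ∀ᶠ y in nhds x, |R y - R x| < Real.pi / 2 := by
    have := Metric.continuousAt_iff'.1 hR (Real.pi / 2) (by positivity)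
    simpa [Real.dist_eq] using this
  have hboth := hRe.and hRR
  filter_upwards [nhdsWithin_le_nhds ((hcont 1).eventually hboth),
    nhdsWithin_le_nhds ((hcont (-1)).eventually hboth), self_mem_nhdsWithin] with t h1 h2 ht
  have e1 : x + (1 * t) • w = x + t • w := by simp
  have e2 : x + (-1 * t) • w = x - t • w := by simp [sub_eq_add_neg]
  rw [e1] at h1
  rw [e2] at h2
  obtain ⟨h1re, h1R⟩ := h1
  obtain ⟨h2re, h2R⟩ := h2
  have ht : 0 < t := ht
  have i1 : (q.2 - (x + t • w).2) * (p.1 - (x + t • w).1)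
      - (q.1 - (x + t • w).1) * (p.2 - (x + t • w).2)
      = t * ((q.1 - p.1) * w.2 - (q.2 - p.2) * w.1) := by
    simp only [Prod.fst_add, Prod.snd_add, Prod.smul_fst, Prod.smul_snd, smul_eq_mul, hx1, hx2]
    ring
  have i2 : (q.2 - (x - t • w).2) * (p.1 - (x - t • w).1)
      - (q.1 - (x - t • w).1) * (p.2 - (x - t • w).2)
      = -(t * ((q.1 - p.1) * w.2 - (q.2 - p.2) * w.1)) := by
    simp only [Prod.fst_sub, Prod.snd_sub, Prod.smul_fst, Prod.smul_snd, smul_eq_mul, hx1, hx2]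
    ring
  rw [abs_lt] at h1R h2R
  rcases lt_or_gt_of_ne hw with hneg | hpos
  · have hm := mul_neg_of_pos_of_neg ht hneg
    have := viewAngle_lt h1re (by rw [i1]; exact hm)
    have := viewAngle_gt h2re (by rw [i2]; linarith)
    intro he
    linarith [h1R.1, h1R.2, h2R.1, h2R.2]
  · have hm := mul_pos ht hpos
    have := viewAngle_gt h1re (by rw [i1]; exact hm)
    have := viewAngle_lt h2re (by rw [i2]; linarith)
    intro he
    linarith [h1R.1, h1R.2, h2R.1, h2R.2]

theorem affine_add_smul_sub (f : Plane →ᵃ[ℝ] ℝ) (y x z : Plane) (t : ℝ) :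
    f (y + t • (x - z)) = f y + t * (f x - f z) := by
  have h := f.map_vadd y (t • (x - z))
  have h2 := f.linearMap_vsub x z
  simp only [vadd_eq_add, vsub_eq_sub, map_smul, smul_eq_mul] at h h2
  rw [add_comm y, h, h2]
  ring

theorem affine_combo (f : Plane →ᵃ[ℝ] ℝ) {s t : ℝ} (hst : s + t = 1) (x y : Plane) :
    f (s • x + t • y) = s * f x + t * f y := by
  simpa using Convex.combo_affine_apply (f := f) (x := x) (y := y) hst

theorem affine_eq_zero_of_mem_segment (f : Plane →ᵃ[ℝ] ℝ) {p q x : Plane} (hp : f p = 0)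
    (hq : f q = 0) (hx : x ∈ segment ℝ p q) : f x = 0 := by
  obtain ⟨s, t, hs, ht, hst, rfl⟩ := hx
  rw [affine_combo _ hst, hp, hq]
  ring

theorem continuous_affine (f : Plane →ᵃ[ℝ] ℝ) : Continuous f :=
  f.continuous_of_finiteDimensional

theorem convex_affine_pos (f : Plane →ᵃ[ℝ] ℝ) : Convex ℝ {x | 0 < f x} :=
  (convex_Ioi (0 : ℝ)).affine_preimage f

theorem convex_affine_neg (f : Plane →ᵃ[ℝ] ℝ) : Convex ℝ {x | f x < 0} :=
  (convex_Iio (0 : ℝ)).affine_preimage f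

namespace AffCoords

variable {O A B : Plane}

/-- The open cone at `O` spanned by `A` and `B`. -/
def inner (c : AffCoords O A B) : Set Plane := {x | 0 < c.a x ∧ 0 < c.b x}

/-- The complement of the closed cone at `O` spanned by `A` and `B`. -/
def outer (c : AffCoords O A B) : Set Plane := {x | c.a x < 0 ∨ c.b x < 0}

theorem a_scale (c : AffCoords O A B) (x : Plane) (t : ℝ) :
    c.a (O + t • (x - O)) = t * c.a x := by
  rw [affine_add_smul_sub, c.a_O]; ring

theorem b_scale (c : AffCoords O A B) (x : Plane) (t : ℝ) :
    c.b (O + t • (x - O)) = t * c.b x := by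
  rw [affine_add_smul_sub, c.b_O]; ring

theorem isOpen_inner (c : AffCoords O A B) : IsOpen c.inner :=
  (isOpen_lt continuous_const (continuous_affine c.a)).inter
    (isOpen_lt continuous_const (continuous_affine c.b))

theorem isOpen_outer (c : AffCoords O A B) : IsOpen c.outer :=
  (isOpen_lt (continuous_affine c.a) continuous_const).union
    (isOpen_lt (continuous_affine c.b) continuous_const)

theorem inner_scale (c : AffCoords O A B) {x : Plane} (hx : x ∈ c.inner) {t : ℝ} (ht : 0 < t) :
    O + t • (x - O) ∈ c.inner := by
  refine ⟨?_, ?_⟩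
  · rw [c.a_scale]; exact mul_pos ht hx.1
  · rw [c.b_scale]; exact mul_pos ht hx.2

theorem outer_scale (c : AffCoords O A B) {x : Plane} (hx : x ∈ c.outer) {t : ℝ} (ht : 0 < t) :
    O + t • (x - O) ∈ c.outer := by
  refine hx.imp (fun h => ?_) (fun h => ?_)
  · rw [c.a_scale]; exact mul_neg_of_pos_of_neg ht h
  · rw [c.b_scale]; exact mul_neg_of_pos_of_neg ht h

end AffCoords

theorem mem_closure_of_eventually {s : Set Plane} {y w : Plane}
    (h : ∀ᶠ t in nhdsWithin (0 : ℝ) (Set.Ioi 0), y + t • w ∈ s) : y ∈ closure s := by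
  have hc : Filter.Tendsto (fun t : ℝ => y + t • w) (nhdsWithin 0 (Set.Ioi 0)) (nhds y) := by
    have : Continuous fun t : ℝ => y + t • w := by fun_prop
    exact (by simpa using this.tendsto 0 : Filter.Tendsto (fun t : ℝ => y + t • w)
      (nhds 0) (nhds y)).mono_left nhdsWithin_le_nhds
  exact mem_closure_of_tendsto hc h

theorem eventually_mem_ball {O y : Plane} {r : ℝ} (hy : y ∈ Metric.ball O r) (w : Plane) :
    ∀ᶠ t in nhdsWithin (0 : ℝ) (Set.Ioi 0), y + t • w ∈ Metric.ball O r := by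
  have hc : Filter.Tendsto (fun t : ℝ => y + t • w) (nhds 0) (nhds y) := by
    have : Continuous fun t : ℝ => y + t • w := by fun_prop
    simpa using this.tendsto 0
  exact nhdsWithin_le_nhds (hc.eventually (Metric.isOpen_ball.mem_nhds hy))

theorem exists_scale_mem_ball (O x : Plane) {r : ℝ} (hr : 0 < r) :
    ∃ t : ℝ, 0 < t ∧ t < 1 ∧ O + t • (x - O) ∈ Metric.ball O r := by
  obtain ⟨t, ht, h0, h1⟩ := ((eventually_mem_ball (Metric.mem_ball_self hr) (x - O)).and
    (Ioo_mem_nhdsGT (one_pos : (0 : ℝ) < 1))).exists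
  exact ⟨t, h0, h1, ht⟩

namespace AffCoords

variable {O A B : Plane}

theorem isPreconnected_inner (c : AffCoords O A B) (r : ℝ) :
    IsPreconnected (c.inner ∩ Metric.ball O r) :=
  (((convex_affine_pos c.a).inter (convex_affine_pos c.b)).inter (convex_ball O r)).isPreconnected

theorem isPreconnected_outer (c : AffCoords O A B) {r : ℝ} (hr : 0 < r) :
    IsPreconnected (c.outer ∩ Metric.ball O r) := by
  obtain ⟨t, ht, -, htb⟩ := exists_scale_mem_ball O (O - (A - O) - (B - O)) hr
  have hz : O + t • (O - (A - O) - (B - O) - O) = O + (-t) • (A - O) + (-t) • (B - O) := by module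
  rw [hz] at htb
  have ha : c.a (O + (-t) • (A - O) + (-t) • (B - O)) < 0 := by
    rw [affine_add_smul_sub, affine_add_smul_sub, c.a_O, c.a_A, c.a_B]; linarith
  have hb : c.b (O + (-t) • (A - O) + (-t) • (B - O)) < 0 := by
    rw [affine_add_smul_sub, affine_add_smul_sub, c.b_O, c.b_A, c.b_B]; linarith
  have : c.outer ∩ Metric.ball O r
      = ({x | c.a x < 0} ∩ Metric.ball O r) ∪ ({x | c.b x < 0} ∩ Metric.ball O r) := by
    rw [← Set.union_inter_distrib_right]; rfl
  rw [this]
  exact IsPreconnected.union _ ⟨ha, htb⟩ ⟨hb, htb⟩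
    ((convex_affine_neg c.a).inter (convex_ball O r)).isPreconnected
    ((convex_affine_neg c.b).inter (convex_ball O r)).isPreconnected

theorem mem_closure_inner (c : AffCoords O A B) {r : ℝ} {y : Plane} (hy : y ∈ Metric.ball O r)
    (ha : 0 ≤ c.a y) (hb : 0 ≤ c.b y) : y ∈ closure (c.inner ∩ Metric.ball O r) := by
  refine mem_closure_of_eventually (w := (A - O) + (B - O)) ?_
  filter_upwards [eventually_mem_ball hy ((A - O) + (B - O)), self_mem_nhdsWithin] with t h1 ht
  have ht : 0 < t := ht
  refine ⟨⟨?_, ?_⟩, h1⟩ <;> rw [smul_add, ← add_assoc, affine_add_smul_sub, affine_add_smul_sub]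
  · rw [c.a_O, c.a_A, c.a_B]; linarith
  · rw [c.b_O, c.b_A, c.b_B]; linarith

theorem mem_closure_outer (c : AffCoords O A B) {r : ℝ} {y : Plane} (hy : y ∈ Metric.ball O r)
    (h : c.a y ≤ 0 ∨ c.b y ≤ 0) : y ∈ closure (c.outer ∩ Metric.ball O r) := by
  refine mem_closure_of_eventually (w := (O - A) + (O - B)) ?_
  filter_upwards [eventually_mem_ball hy ((O - A) + (O - B)), self_mem_nhdsWithin] with t h1 ht
  have ht : 0 < t := ht
  refine ⟨?_, h1⟩
  refine h.imp (fun h => ?_) (fun h => ?_) <;>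
    rw [smul_add, ← add_assoc, affine_add_smul_sub, affine_add_smul_sub]
  · rw [c.a_O, c.a_A, c.a_B]; linarith
  · rw [c.b_O, c.b_A, c.b_B]; linarith

end AffCoords

theorem IsPreconnected.subset_interior_or_disjoint {P s : Set Plane} (hs : IsPreconnected s)
    (hd : ∀ x ∈ s, x ∉ frontier P) : s ⊆ interior P ∨ s ⊆ Pᶜ := by
  have hcov : s ⊆ interior P ∪ (closure P)ᶜ := by
    intro x hx
    by_cases h : x ∈ closure P
    · by_cases h' : x ∈ interior P
      · exact Or.inl h'
      · exact (hd x hx ⟨h, h'⟩).elim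
    · exact Or.inr h
  have hdis : Disjoint (interior P) (closure P)ᶜ :=
    Set.disjoint_left.2 fun x hx h => h (subset_closure (interior_subset hx))
  rcases hs.subset_or_subset isOpen_interior isClosed_closure.isOpen_compl hdis hcov with h | h
  · exact Or.inl h
  · exact Or.inr fun x hx hxP => h hx (subset_closure hxP)

theorem AffCoords.isPreconnected_ball_diff {O A B : Plane} (c : AffCoords O A B) {P : Set Plane}
    (hP : IsClosed P) {r : ℝ} (hr : 0 < r)
    (hi : ∀ x ∈ c.inner ∩ Metric.ball O r, x ∉ frontier P)
    (ho : ∀ x ∈ c.outer ∩ Metric.ball O r, x ∉ frontier P)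
    (hOf : O ∈ frontier P) (hOc : O ∈ closure (interior P)) :
    IsPreconnected (Metric.ball O r \ P) := by
  have hOP : O ∉ interior P := hOf.2
  have hcl : ∀ s : Set Plane, s ⊆ interior P → closure s ⊆ P := fun s hs =>
    closure_minimal (hs.trans interior_subset) hP
  have hcases : ∀ y ∈ Metric.ball O r, (y ∈ c.inner ∨ y ∈ c.outer) ∨
      (y ∈ closure (c.inner ∩ Metric.ball O r) ∧ y ∈ closure (c.outer ∩ Metric.ball O r)) := by
    intro y hy
    by_cases h : y ∈ c.outer
    · exact Or.inl (Or.inr h)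
    by_cases h' : y ∈ c.inner
    · exact Or.inl (Or.inl h')
    simp only [AffCoords.outer, AffCoords.inner, Set.mem_ofPred_eq, not_or, not_and_or, not_lt]
      at h h'
    exact Or.inr ⟨c.mem_closure_inner hy h.1 h.2, c.mem_closure_outer hy h'⟩
  rcases (c.isPreconnected_inner r).subset_interior_or_disjoint hi with h1 | h1 <;>
    rcases (c.isPreconnected_outer hr).subset_interior_or_disjoint ho with h2 | h2
  · exfalso
    apply hOP
    refine mem_interior.2 ⟨Metric.ball O r, fun y hy => ?_, Metric.isOpen_ball,
      Metric.mem_ball_self hr⟩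
    rcases hcases y hy with (h | h) | ⟨h, -⟩
    · exact interior_subset (h1 ⟨h, hy⟩)
    · exact interior_subset (h2 ⟨h, hy⟩)
    · exact hcl _ h1 h
  · have : Metric.ball O r \ P = c.outer ∩ Metric.ball O r := by
      ext y
      refine ⟨fun ⟨hy, hyP⟩ => ?_, fun hy => ⟨hy.2, h2 hy⟩⟩
      rcases hcases y hy with (h | h) | ⟨h, -⟩
      · exact (hyP (interior_subset (h1 ⟨h, hy⟩))).elim
      · exact ⟨h, hy⟩
      · exact (hyP (hcl _ h1 h)).elim
    rw [this]
    exact c.isPreconnected_outer hr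
  · have : Metric.ball O r \ P = c.inner ∩ Metric.ball O r := by
      ext y
      refine ⟨fun ⟨hy, hyP⟩ => ?_, fun hy => ⟨hy.2, h1 hy⟩⟩
      rcases hcases y hy with (h | h) | ⟨-, h⟩
      · exact ⟨h, hy⟩
      · exact (hyP (interior_subset (h2 ⟨h, hy⟩))).elim
      · exact (hyP (hcl _ h2 h)).elim
    rw [this]
    exact c.isPreconnected_inner r
  · exfalso
    obtain ⟨y, hyb, hyi⟩ := mem_closure_iff.1 hOc _ Metric.isOpen_ball (Metric.mem_ball_self hr)
    have hy : y ∈ closure (Pᶜ) := by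
      rcases hcases y hyb with (h | h) | ⟨h, -⟩
      · exact subset_closure (h1 ⟨h, hyb⟩)
      · exact subset_closure (h2 ⟨h, hyb⟩)
      · exact closure_mono h1 h
    rw [closure_compl] at hy
    exact hy hyi

/-- The total angle differs between the two sectors that a closed polygon cuts out at `O`. -/
theorem AffCoords.totalAngle_ne {u : ℕ → Plane} {O : Plane} {l k : ℕ} (hlk : l < k)
    (c : AffCoords O (u l) (u k)) {r : ℝ} (hr : 0 < r)
    (hM : ∀ j, l ≤ j → j < k → ∀ x ∈ Metric.ball O r, x ∉ segment ℝ (u j) (u (j + 1)))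
    {x y : Plane} (hx : x ∈ c.inner ∩ Metric.ball O r) (hy : y ∈ c.outer ∩ Metric.ball O r) :
    totalAngle u O l k x ≠ totalAngle u O l k y := by
  intro hxy
  have hsegA : ∀ z ∈ segment ℝ O (u l), 0 ≤ c.a z ∧ c.b z = 0 := by
    rintro z ⟨s, t, hs, ht, hst, rfl⟩
    rw [affine_combo _ hst, affine_combo _ hst, c.a_O, c.b_O, c.a_A, c.b_A]
    exact ⟨by linarith, by ring⟩
  have hsegB : ∀ z ∈ segment ℝ O (u k), c.a z = 0 ∧ 0 ≤ c.b z := by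
    rintro z ⟨s, t, hs, ht, hst, rfl⟩
    rw [affine_combo _ hst, affine_combo _ hst, c.a_O, c.b_O, c.a_B, c.b_B]
    exact ⟨by ring, by linarith⟩
  have hdi : ∀ z ∈ c.inner ∩ Metric.ball O r, z ∉ closedChain u O l k := by
    rintro z ⟨⟨ha, hb⟩, hz⟩ (h | h | ⟨j, hj, hj', h⟩)
    · linarith [(hsegA z h).2]
    · linarith [(hsegB z h).1]
    · exact hM j hj hj' z hz h
  have hdo : ∀ z ∈ c.outer ∩ Metric.ball O r, z ∉ closedChain u O l k := by
    rintro z ⟨hab, hz⟩ (h | h | ⟨j, hj, hj', h⟩)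
    · rcases hab with h' | h' <;> linarith [(hsegA z h).1, (hsegA z h).2]
    · rcases hab with h' | h' <;> linarith [(hsegB z h).1, (hsegB z h).2]
    · exact hM j hj hj' z hz h
  obtain ⟨t, ht, ht1, htb⟩ := exists_scale_mem_ball O (u l) hr
  set p := O + t • (u l - O) with hp
  have hpa : c.a p = t := by rw [hp, c.a_scale, c.a_A, mul_one]
  have hpb : c.b p = 0 := by rw [hp, c.b_scale, c.b_A, mul_zero]
  have hpo : p ∈ openSegment ℝ O (u l) := ⟨1 - t, t, by linarith, ht, by ring, by rw [hp]; module⟩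
  have hR : ContinuousAt (fun z => ∑ j ∈ Finset.Ico l k, viewAngle (u j) (u (j + 1)) z
      + viewAngle (u k) O z) p := by
    refine ContinuousAt.add (tendsto_finsetSum _ fun j hj => ?_) (continuousAt_viewAngle ?_)
    · rw [Finset.mem_Ico] at hj
      exact continuousAt_viewAngle (hM j hj.1 hj.2 p htb)
    · rw [segment_symm]
      intro h
      linarith [(hsegB p h).1]
  obtain ⟨s, ⟨⟨hs1, hs2⟩, hs3⟩, hs⟩ := (((eventually_viewAngle_jump (w := u k - O) hpo hR
    (by simpa using c.cross_ne)).and (eventually_mem_ball htb (u k - O))).and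
    (eventually_mem_ball htb (O - u k)) |>.and self_mem_nhdsWithin).exists
  have hs : 0 < s := hs
  have e : p - s • (u k - O) = p + s • (O - u k) := by module
  apply hs1
  have h1 : p + s • (u k - O) ∈ c.inner ∩ Metric.ball O r := by
    refine ⟨⟨?_, ?_⟩, hs2⟩ <;> rw [affine_add_smul_sub]
    · rw [c.a_O, c.a_B]; linarith
    · rw [c.b_O, c.b_B]; linarith
  have h2 : p - s • (u k - O) ∈ c.outer ∩ Metric.ball O r := by
    rw [e]
    refine ⟨Or.inr ?_, hs3⟩
    rw [affine_add_smul_sub, c.b_O, c.b_B]; linarith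
  have e1 := (c.isPreconnected_inner r).totalAngle_eq hlk hdi h1 hx
  have e2 := (c.isPreconnected_outer hr).totalAngle_eq hlk hdo h2 hy
  have e3 := (e1.trans hxy).trans e2.symm
  simp only [totalAngle, add_assoc] at e3
  exact e3

/-- A simple polygon in general position whose vertices are listed along the natural numbers. -/
structure IndexedPolygon (n : ℕ) (u : ℕ → Plane) (P : Set Plane) : Prop where
  three_le : 3 ≤ n
  compact : IsCompact P
  regular : P ⊆ closure (interior P)
  mem_frontier : ∀ x, x ∈ frontier P ↔ ∃ a < n, x ∈ segment ℝ (u a) (u (a + 1))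
  wrap : u n = u 0
  inter : ∀ a b, a < n → b < n → a ≠ b → ∀ x, x ∈ segment ℝ (u a) (u (a + 1)) →
    x ∈ segment ℝ (u b) (u (b + 1)) → ∃ m < n, x = u m
  not_collinear : ∀ a b c, a < n → b < n → c < n → a ≠ b → a ≠ c → b ≠ c →
    ¬ Collinear ℝ ({u a, u b, u c} : Set Plane)

theorem exists_ball_disjoint_edges (n : ℕ) (u : ℕ → Plane) (x : Plane) :
    ∃ r > 0, ∀ a < n, x ∉ segment ℝ (u a) (u (a + 1)) →
      ∀ y ∈ Metric.ball x r, y ∉ segment ℝ (u a) (u (a + 1)) := by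
  have : ∀ᶠ y in nhds x, ∀ a ∈ Finset.range n, x ∉ segment ℝ (u a) (u (a + 1)) →
      y ∉ segment ℝ (u a) (u (a + 1)) := by
    rw [Filter.eventually_all_finset]
    intro a _
    by_cases h : x ∈ segment ℝ (u a) (u (a + 1))
    · simp [h]
    · filter_upwards [(isClosed_segment (u a) (u (a + 1))).isOpen_compl.mem_nhds h] with y hy _
      exact hy
  obtain ⟨r, hr, h⟩ := Metric.eventually_nhds_iff_ball.1 this
  exact ⟨r, hr, fun a ha hx y hy => h y hy a (Finset.mem_range.2 ha) hx⟩

theorem collinear_of_mem_segment {x y z : Plane} (h : y ∈ segment ℝ x z) :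
    Collinear ℝ ({x, y, z} : Set Plane) :=
  (mem_segment_iff_wbtw.1 h).collinear

theorem AffCoords.collinear_of_b_eq_zero {O A B : Plane} (c : AffCoords O A B) {x : Plane}
    (h : c.b x = 0) : Collinear ℝ ({O, A, x} : Set Plane) := by
  rw [collinear_iff_of_mem (p₀ := O) (by simp)]
  refine ⟨A - O, ?_⟩
  intro p hp
  simp only [Set.mem_insert_iff, Set.mem_singleton_iff] at hp
  rcases hp with rfl | rfl | rfl
  · exact ⟨0, by simp⟩
  · exact ⟨1, by simp⟩
  · refine ⟨c.a p, ?_⟩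
    have := c.eq p
    rw [h, zero_smul, add_zero] at this
    rw [vadd_eq_add, add_comm]
    exact this

theorem AffCoords.collinear_of_a_eq_zero {O A B : Plane} (c : AffCoords O A B) {x : Plane}
    (h : c.a x = 0) : Collinear ℝ ({O, B, x} : Set Plane) := by
  rw [collinear_iff_of_mem (p₀ := O) (by simp)]
  refine ⟨B - O, ?_⟩
  intro p hp
  simp only [Set.mem_insert_iff, Set.mem_singleton_iff] at hp
  rcases hp with rfl | rfl | rfl
  · exact ⟨0, by simp⟩
  · exact ⟨1, by simp⟩
  · refine ⟨c.b p, ?_⟩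
    have := c.eq p
    rw [h, zero_smul, zero_add] at this
    rw [vadd_eq_add, add_comm]
    exact this

namespace IndexedPolygon

variable {n : ℕ} {u : ℕ → Plane} {P : Set Plane}

theorem ne (hp : IndexedPolygon n u P) {a b : ℕ} (ha : a < n) (hb : b < n) (hab : a ≠ b) :
    u a ≠ u b := by
  intro h
  have := hp.three_le
  obtain ⟨c, hc, hca, hcb⟩ : ∃ c < n, a ≠ c ∧ b ≠ c := by
    by_cases h0 : a ≠ 0 ∧ b ≠ 0
    · exact ⟨0, by omega, h0.1, h0.2⟩
    by_cases h1 : a ≠ 1 ∧ b ≠ 1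
    · exact ⟨1, by omega, h1.1, h1.2⟩
    exact ⟨2, by omega, by omega, by omega⟩
  apply hp.not_collinear a b c ha hb hc hab hca hcb
  rw [h]
  simpa using collinear_pair ℝ (u b) (u c)

theorem frontier_subset (hp : IndexedPolygon n u P) : frontier P ⊆ P :=
  hp.compact.isClosed.frontier_subset

theorem edge_subset (hp : IndexedPolygon n u P) {a : ℕ} (ha : a < n) :
    segment ℝ (u a) (u (a + 1)) ⊆ P := fun x hx =>
  hp.frontier_subset ((hp.mem_frontier x).2 ⟨a, ha, hx⟩)

theorem exists_next (hp : IndexedPolygon n u P) {a : ℕ} (ha : a < n) :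
    ∃ e < n, e ≠ a ∧ u (a + 1) = u e ∧ (e = a + 1 ∨ e = 0 ∧ a + 1 = n) := by
  have := hp.three_le
  by_cases h : a + 1 = n
  · exact ⟨0, by omega, by omega, by rw [h, hp.wrap], Or.inr ⟨rfl, h⟩⟩
  · exact ⟨a + 1, by omega, by omega, rfl, Or.inl rfl⟩

theorem eq_of_vertex_mem_edge (hp : IndexedPolygon n u P) {m a : ℕ} (hm : m < n) (ha : a < n)
    (h : u m ∈ segment ℝ (u a) (u (a + 1))) : m = a ∨ m = a + 1 ∨ m = 0 ∧ a + 1 = n := by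
  obtain ⟨e, he, hea, hue, hcase⟩ := hp.exists_next ha
  by_contra hc
  have h1 : a ≠ m := by omega
  have h2 : m ≠ e := by omega
  rw [hue] at h
  exact hp.not_collinear a m e ha hm he h1 hea.symm h2 (collinear_of_mem_segment h)

/-- A vertex visible from `u 0` is seen along an edge or through the interior. -/
theorem edge_of_mem_openSegment (hp : IndexedPolygon n u P) {m a : ℕ} (hm1 : 1 ≤ m) (hm : m < n)
    (ha : a < n) (hvis : segment ℝ (u 0) (u m) ⊆ P) {x : Plane}
    (hx : x ∈ openSegment ℝ (u 0) (u m)) (hxa : x ∈ segment ℝ (u a) (u (a + 1))) :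
    u m ∈ segment ℝ (u a) (u (a + 1)) ∧
      segment ℝ (u a) (u (a + 1)) ⊆ segment ℝ (u 0) (u m) := by
  have hn := hp.three_le
  have h0m : u 0 ≠ u m := hp.ne (by omega) hm (by omega)
  have hxv : ∀ j < n, x ≠ u j := by
    rintro j hj rfl
    rcases eq_or_ne j 0 with rfl | hj0
    · exact h0m (left_mem_openSegment_iff.1 hx)
    rcases eq_or_ne j m with rfl | hjm
    · exact h0m (right_mem_openSegment_iff.1 hx)
    exact hp.not_collinear 0 j m (by omega) hj hm hj0.symm (by omega) hjm
      (collinear_of_mem_segment (openSegment_subset_segment _ _ _ hx))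
  have hxb : ∀ b < n, b ≠ a → x ∉ segment ℝ (u b) (u (b + 1)) := by
    intro b hb hba hxb
    obtain ⟨j, hj, h⟩ := hp.inter b a hb ha hba x hxb hxa
    exact hxv j hj h
  obtain ⟨e, he, hea, hue, -⟩ := hp.exists_next ha
  rw [hue] at hxa ⊢
  by_cases hcase : (0 = a ∧ m = e) ∨ (0 = e ∧ m = a)
  · rcases hcase with ⟨rfl, rfl⟩ | ⟨rfl, rfl⟩
    · exact ⟨right_mem_segment ℝ _ _, subset_rfl⟩
    · exact ⟨left_mem_segment ℝ _ _, by rw [segment_symm]⟩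
  exfalso
  obtain ⟨j, hj, hj0m, hja, hje⟩ : ∃ j < n, (j = 0 ∨ j = m) ∧ j ≠ a ∧ j ≠ e := by
    by_cases h : 0 ≠ a ∧ 0 ≠ e
    · exact ⟨0, by omega, Or.inl rfl, h⟩
    · exact ⟨m, hm, Or.inr rfl, by omega, by omega⟩
  obtain ⟨c⟩ := exists_affCoords (hp.not_collinear a e j ha he hj hea.symm hja.symm hje.symm)
  have hxc : c.b x = 0 := affine_eq_zero_of_mem_segment _ c.b_O c.b_A hxa
  obtain ⟨r, hr, hball⟩ := exists_ball_disjoint_edges n u x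
  have hoff : ∀ y ∈ Metric.ball x r, c.b y ≠ 0 → y ∉ frontier P := by
    intro y hy hcy hyf
    obtain ⟨b, hb, hyb⟩ := (hp.mem_frontier y).1 hyf
    rcases eq_or_ne b a with rfl | hba
    · rw [hue] at hyb
      exact hcy (affine_eq_zero_of_mem_segment _ c.b_O c.b_A hyb)
    · exact hball b hb (hxb b hb hba) y hy hyb
  have hne : c.b (u m) ≠ c.b (u 0) := by
    intro heq
    obtain ⟨s, t, hs, ht, hst, rfl⟩ := hx
    rw [affine_combo _ hst, heq] at hxc
    have h1 : c.b (u 0) = 0 := by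
      have : (s + t) * c.b (u 0) = 0 := by linarith
      rwa [hst, one_mul] at this
    have h2 := c.b_B
    rcases hj0m with rfl | rfl
    · linarith
    · linarith
  have hev : ∀ σ : ℝ, σ = 1 ∨ σ = -1 → ∃ t : ℝ, 0 < t ∧
      x + t • (σ • (u m - u 0)) ∈ Metric.ball x r ∩ P := by
    intro σ hσ
    obtain ⟨s, t, hs, ht, hst, hxe⟩ := hx
    obtain ⟨τ, hτb, hτ0, hτ1⟩ := ((eventually_mem_ball (Metric.mem_ball_self hr)
      (σ • (u m - u 0))).and (Ioo_mem_nhdsGT (lt_min hs ht))).exists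
    rw [lt_min_iff] at hτ1
    refine ⟨τ, hτ0, hτb, hvis ?_⟩
    rcases hσ with rfl | rfl
    · exact ⟨s - τ, t + τ, by linarith, by linarith, by linarith, by rw [← hxe]; module⟩
    · exact ⟨s + τ, t - τ, by linarith, by linarith, by linarith, by rw [← hxe]; module⟩
  have hside : ∀ σ : ℝ, σ = 1 ∨ σ = -1 →
      {y | 0 < (σ • c.b) y} ∩ Metric.ball x r ⊆ interior P := by
    intro σ hσ
    have hpre : IsPreconnected ({y | 0 < (σ • c.b) y} ∩ Metric.ball x r) :=
      ((convex_affine_pos _).inter (convex_ball x r)).isPreconnected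
    refine (hpre.subset_interior_or_disjoint ?_).resolve_right ?_
    · rintro y ⟨hy, hyb⟩
      refine hoff y hyb fun h => ?_
      simp [h] at hy
    · intro hsub
      have key : ∀ ρ : ℝ, ρ = 1 ∨ ρ = -1 → 0 < σ * (ρ * (c.b (u m) - c.b (u 0))) → False := by
        intro ρ hρ hpos
        obtain ⟨t, ht, htb, htP⟩ := hev ρ hρ
        refine hsub ⟨?_, htb⟩ htP
        change 0 < σ * c.b _
        rw [smul_smul, affine_add_smul_sub, hxc]
        nlinarith
      rcases lt_or_gt_of_ne (sub_ne_zero.2 hne) with h | h <;> rcases hσ with rfl | rfl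
      · exact key (-1) (Or.inr rfl) (by linarith)
      · exact key 1 (Or.inl rfl) (by linarith)
      · exact key 1 (Or.inl rfl) (by linarith)
      · exact key (-1) (Or.inr rfl) (by linarith)
  have hxf : x ∈ frontier P := (hp.mem_frontier x).2 ⟨a, ha, by rwa [hue]⟩
  refine hxf.2 (mem_interior.2 ⟨Metric.ball x r, fun y hy => ?_, Metric.isOpen_ball,
    Metric.mem_ball_self hr⟩)
  rcases lt_trichotomy (c.b y) 0 with h | h | h
  · exact interior_subset (hside (-1) (Or.inr rfl) ⟨by change 0 < (-1 : ℝ) * c.b y; linarith, hy⟩)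
  · have : y ∈ closure (interior P) := by
      refine mem_closure_of_eventually (w := u j - u a) ?_
      filter_upwards [eventually_mem_ball hy (u j - u a), self_mem_nhdsWithin] with t ht1 ht
      have ht : 0 < t := ht
      refine hside 1 (Or.inl rfl) ⟨?_, ht1⟩
      change 0 < (1 : ℝ) * c.b _
      rw [affine_add_smul_sub, h, c.b_B, c.b_O]
      linarith
    exact closure_minimal interior_subset hp.compact.isClosed this
  · exact interior_subset (hside 1 (Or.inl rfl) ⟨by change 0 < (1 : ℝ) * c.b y; linarith, hy⟩)

end IndexedPolygon

theorem left_notMem_segment {O q x y : Plane} (hx : x ∈ segment ℝ O q)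
    (hy : y ∈ segment ℝ O q) (hxO : x ≠ O) (hyO : y ≠ O) : O ∉ segment ℝ x y := by
  rintro ⟨s, t, hs, ht, hst, h⟩
  obtain ⟨x₀, ξ, hx₀, hξ, hxs, rfl⟩ := hx
  obtain ⟨y₀, η, hy₀, hη, hys, rfl⟩ := hy
  obtain rfl : x₀ = 1 - ξ := by linarith
  obtain rfl : y₀ = 1 - η := by linarith
  obtain rfl : s = 1 - t := by linarith
  have hξ0 : 0 < ξ := lt_of_le_of_ne hξ fun e => hxO (by rw [← e]; simp)
  have hη0 : 0 < η := lt_of_le_of_ne hη fun e => hyO (by rw [← e]; simp)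
  have h2 : ((1 - t) * ξ + t * η) • (q - O) = 0 := by
    have : ((1 - t) * ξ + t * η) • (q - O)
      = ((1 - t) • ((1 - ξ) • O + ξ • q) + t • ((1 - η) • O + η • q)) - O := by module
    rw [this, h, sub_self]
  rcases smul_eq_zero.1 h2 with h3 | h3
  · have h4 : 0 ≤ (1 - t) * ξ := mul_nonneg hs hξ
    have h5 : 0 ≤ t * η := mul_nonneg ht hη
    have h6 : t = 0 := by
      have : t * η = 0 := by linarith
      exact (mul_eq_zero.1 this).resolve_right hη0.ne'
    rw [h6] at h3
    linarith
  · apply hxO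
    rw [sub_eq_zero] at h3
    rw [h3]
    module

namespace IndexedPolygon

variable {n : ℕ} {u : ℕ → Plane} {P : Set Plane} {l k : ℕ}

theorem closedChain_subset (hp : IndexedPolygon n u P) (hkn : k < n)
    (hA : segment ℝ (u 0) (u l) ⊆ P) (hB : segment ℝ (u 0) (u k) ⊆ P) :
    closedChain u (u 0) l k ⊆ P := by
  rintro x (h | h | ⟨j, -, hj, h⟩)
  · exact hA h
  · exact hB h
  · exact hp.edge_subset (by omega) h

theorem notMem_closedChain_of_mem_edge (hp : IndexedPolygon n u P) (hl : 1 ≤ l) (hlk : l < k)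
    (hkn : k < n) (hA : segment ℝ (u 0) (u l) ⊆ P) (hB : segment ℝ (u 0) (u k) ⊆ P) {a : ℕ}
    (ha : a < n) (hal : a + 1 < l ∨ k < a) {x : Plane} (hx : x ∈ segment ℝ (u a) (u (a + 1)))
    (hx0 : x ≠ u 0) : x ∉ closedChain u (u 0) l k := by
  have hdiag : ∀ m, l ≤ m → m ≤ k → segment ℝ (u 0) (u m) ⊆ P →
      x ∉ segment ℝ (u 0) (u m) := by
    intro m hml hmk hvis hxm
    have hma : u m ∈ segment ℝ (u a) (u (a + 1)) := by
      rcases eq_or_ne (u m) x with h | h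
      · rwa [h]
      · exact (hp.edge_of_mem_openSegment (by omega) (by omega) ha hvis
          (mem_openSegment_of_ne_left_right hx0.symm h hxm) hx).1
    have := hp.eq_of_vertex_mem_edge (by omega) ha hma
    omega
  rintro (h | h | ⟨b, hb, hbk, h⟩)
  · exact hdiag l le_rfl hlk.le hA h
  · exact hdiag k hlk.le le_rfl hB h
  · obtain ⟨m, hm, rfl⟩ := hp.inter a b ha (by omega) (by omega) x hx h
    have h1 := hp.eq_of_vertex_mem_edge hm ha hx
    have h2 := hp.eq_of_vertex_mem_edge hm (by omega) h
    omega

theorem totalAngle_eq_of_mem_edge (hp : IndexedPolygon n u P) (hl : 1 ≤ l) (hlk : l < k)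
    (hkn : k < n) (hA : segment ℝ (u 0) (u l) ⊆ P) (hB : segment ℝ (u 0) (u k) ⊆ P) {a : ℕ}
    (ha : a < n) (hal : a + 1 < l ∨ k < a) {x y : Plane}
    (hx : x ∈ segment ℝ (u a) (u (a + 1))) (hx0 : x ≠ u 0)
    (hy : y ∈ segment ℝ (u a) (u (a + 1))) (hy0 : y ≠ u 0) :
    totalAngle u (u 0) l k x = totalAngle u (u 0) l k y := by
  refine (convex_segment x y).isPreconnected.totalAngle_eq hlk (fun z hz => ?_)
    (left_mem_segment ℝ x y) (right_mem_segment ℝ x y)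
  have hza := (convex_segment _ _).segment_subset hx hy hz
  refine hp.notMem_closedChain_of_mem_edge hl hlk hkn hA hB ha hal hza ?_
  rintro rfl
  rcases hp.eq_of_vertex_mem_edge (by omega) ha hza with h | h | ⟨-, h⟩
  · rw [← h] at hx hy
    exact left_notMem_segment hx hy hx0 hy0 hz
  · omega
  · rw [h, hp.wrap, segment_symm] at hx hy
    exact left_notMem_segment hx hy hx0 hy0 hz

/-- One of the two sectors at `u 0` between `u l` and `u k` starts in the interior of the polygon,
and all vertices that it sees lie on the chain from `u l` to `u k`. -/
theorem exists_sector (hp : IndexedPolygon n u P) (hl : 1 ≤ l) (hlk : l < k) (hkn : k < n)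
    (hA : segment ℝ (u 0) (u l) ⊆ P) (hB : segment ℝ (u 0) (u k) ⊆ P)
    (c : AffCoords (u 0) (u l) (u k)) :
    ∃ r > 0, ∃ S : Set Plane, (S = c.inner ∨ S = c.outer) ∧
      S ∩ Metric.ball (u 0) r ⊆ interior P ∧
      ∀ m, 1 ≤ m → m < n → u m ∈ S → segment ℝ (u 0) (u m) ⊆ P → l ≤ m ∧ m ≤ k := by
  have hn := hp.three_le
  have hcl := hp.compact.isClosed
  obtain ⟨c₁⟩ := exists_affCoords (hp.not_collinear 0 1 (n - 1) (by omega) (by omega) (by omega)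
    (by omega) (by omega) (by omega))
  obtain ⟨r, hr, hball⟩ := exists_ball_disjoint_edges n u (u 0)
  replace hball : ∀ a, 1 ≤ a → a + 1 < n → ∀ y ∈ Metric.ball (u 0) r,
      y ∉ segment ℝ (u a) (u (a + 1)) := by
    intro a ha1 han
    refine hball a (by omega) fun h => ?_
    have := hp.eq_of_vertex_mem_edge (by omega) (by omega) h
    omega
  have hfr : ∀ x ∈ Metric.ball (u 0) r, x ∈ frontier P →
      (0 ≤ c₁.a x ∧ c₁.b x = 0) ∨ (c₁.a x = 0 ∧ 0 ≤ c₁.b x) := by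
    intro x hx hxf
    obtain ⟨a, ha, hxa⟩ := (hp.mem_frontier x).1 hxf
    rcases eq_or_ne a 0 with rfl | ha0
    · left
      obtain ⟨s, t, hs, ht, hst, rfl⟩ := hxa
      rw [affine_combo _ hst, affine_combo _ hst, zero_add, c₁.a_O, c₁.b_O, c₁.a_A, c₁.b_A]
      exact ⟨by linarith, by ring⟩
    rcases eq_or_ne (a + 1) n with han | han
    · right
      obtain rfl : a = n - 1 := by omega
      rw [han, hp.wrap] at hxa
      obtain ⟨s, t, hs, ht, hst, rfl⟩ := hxa
      rw [affine_combo _ hst, affine_combo _ hst, c₁.a_O, c₁.b_O, c₁.a_B, c₁.b_B]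
      exact ⟨by ring, by linarith⟩
    · exact (hball a (by omega) (by omega) x hx hxa).elim
  have hOf : u 0 ∈ frontier P :=
    (hp.mem_frontier _).2 ⟨0, by omega, left_mem_segment ℝ _ _⟩
  have hXpre : IsPreconnected (Metric.ball (u 0) r \ P) := by
    refine c₁.isPreconnected_ball_diff hcl hr ?_ ?_ hOf (hp.regular (hp.frontier_subset hOf))
    · rintro x ⟨⟨h1, h2⟩, hx⟩ hxf
      rcases hfr x hx hxf with h | h <;> linarith [h.1, h.2]
    · rintro x ⟨h1, hx⟩ hxf
      rcases hfr x hx hxf with h | h <;> rcases h1 with h1 | h1 <;> linarith [h.1, h.2]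
  have hXcl : ∀ y ∈ Metric.ball (u 0) r, y ∈ frontier P →
      y ∈ closure (Metric.ball (u 0) r \ P) := by
    intro y hy hyf
    rw [frontier_eq_closure_inter_closure] at hyf
    exact Metric.isOpen_ball.inter_closure ⟨hy, hyf.2⟩
  have hCP := hp.closedChain_subset hkn hA hB
  obtain ⟨y₀, hy₀⟩ := closure_nonempty_iff.1 ⟨_, hXcl _ (Metric.mem_ball_self hr) hOf⟩
  set w := totalAngle u (u 0) l k with hw
  have hXw : ∀ y ∈ Metric.ball (u 0) r \ P, w y = w y₀ := fun y hy =>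
    hXpre.totalAngle_eq hlk (fun z hz h => hz.2 (hCP h)) hy hy₀
  have hFw : ∀ y ∈ Metric.ball (u 0) r, y ∈ frontier P → y ∉ closedChain u (u 0) l k →
      w y = w y₀ := by
    intro y hy hyf hyC
    have hpre : IsPreconnected (insert y (Metric.ball (u 0) r \ P)) :=
      hXpre.subset_closure (Set.subset_insert _ _)
        (Set.insert_subset (hXcl y hy hyf) subset_closure)
    refine hpre.totalAngle_eq hlk ?_ (Set.mem_insert _ _) (Set.mem_insert_of_mem _ hy₀)
    rintro z (rfl | hz)
    · exact hyC
    · exact fun h => hz.2 (hCP h)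
  have hstart : ∀ a m, a < n → (a + 1 < l ∨ k < a) → 1 ≤ m → m < n →
      segment ℝ (u a) (u (a + 1)) = segment ℝ (u 0) (u m) → w (u m) = w y₀ := by
    intro a m ha hal hm1 hm hseg
    have hne : u m ≠ u 0 := hp.ne hm (by omega) (by omega)
    obtain ⟨t, ht, ht1, htb⟩ := exists_scale_mem_ball (u 0) (u m) hr
    have hya : u 0 + t • (u m - u 0) ∈ segment ℝ (u a) (u (a + 1)) := by
      rw [hseg]
      exact ⟨1 - t, t, by linarith, ht.le, by ring, by module⟩
    have hy0 : u 0 + t • (u m - u 0) ≠ u 0 := by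
      intro h
      rcases smul_eq_zero.1 (add_eq_left.1 h) with h | h
      · exact ht.ne' h
      · exact hne (sub_eq_zero.1 h)
    rw [← hFw _ htb ((hp.mem_frontier _).2 ⟨a, ha, hya⟩)
      (hp.notMem_closedChain_of_mem_edge hl hlk hkn hA hB ha hal hya hy0)]
    exact hp.totalAngle_eq_of_mem_edge hl hlk hkn hA hB ha hal
      (by rw [hseg]; exact right_mem_segment ℝ _ _) hne hya hy0
  have hstep : ∀ a, 1 ≤ a → a + 1 < n → (a + 1 < l ∨ k < a) → w (u a) = w (u (a + 1)) := by
    intro a ha1 han hal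
    exact hp.totalAngle_eq_of_mem_edge hl hlk hkn hA hB (by omega) hal (left_mem_segment ℝ _ _)
      (hp.ne (by omega) (by omega) (by omega)) (right_mem_segment ℝ _ _)
      (hp.ne han (by omega) (by omega))
  have hlow : ∀ m, 1 ≤ m → m < l → w (u m) = w y₀ := by
    intro m hm
    induction m, hm using Nat.le_induction with
    | base => exact fun h => hstart 0 1 (by omega) (Or.inl (by omega)) le_rfl (by omega) rfl
    | succ m hm ih =>
      intro h
      rw [← hstep m hm (by omega) (Or.inl (by omega))]
      exact ih (by omega)
  have hhigh : ∀ d m, m + d + 1 = n → k < m → w (u m) = w y₀ := by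
    intro d
    induction d with
    | zero =>
      intro m hm hkm
      refine hstart m m (by omega) (Or.inr hkm) (by omega) (by omega) ?_
      rw [show m + 1 = n by omega, hp.wrap, segment_symm]
    | succ d ih =>
      intro m hm hkm
      rw [hstep m (by omega) (by omega) (Or.inr hkm)]
      exact ih (m + 1) (by omega) (by omega)
  have hout : ∀ m, 1 ≤ m → m < n → ¬(l ≤ m ∧ m ≤ k) → w (u m) = w y₀ := by
    intro m hm1 hmn h
    by_cases hml : m < l
    · exact hlow m hm1 hml
    · exact hhigh (n - 1 - m) m (by omega) (by omega)
  obtain ⟨S, hS, hSw⟩ : ∃ S : Set Plane, (S = c.inner ∨ S = c.outer) ∧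
      ∀ x ∈ S ∩ Metric.ball (u 0) r, w x ≠ w y₀ := by
    by_cases h : ∀ x ∈ c.inner ∩ Metric.ball (u 0) r, w x ≠ w y₀
    · exact ⟨_, Or.inl rfl, h⟩
    push Not at h
    obtain ⟨x, hx, hxw⟩ := h
    refine ⟨_, Or.inr rfl, fun y hy => ?_⟩
    rw [← hxw]
    exact (c.totalAngle_ne hlk hr (fun j hj hjk => hball j (by omega) (by omega)) hx hy).symm
  have hSo : IsOpen S := by
    rcases hS with rfl | rfl
    · exact c.isOpen_inner
    · exact c.isOpen_outer
  have hSs : ∀ x ∈ S, ∀ t : ℝ, 0 < t → u 0 + t • (x - u 0) ∈ S := by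
    rcases hS with rfl | rfl
    · exact fun x hx t ht => c.inner_scale hx ht
    · exact fun x hx t ht => c.outer_scale hx ht
  refine ⟨r, hr, S, hS, interior_maximal (fun x hx => ?_) (hSo.inter Metric.isOpen_ball), ?_⟩
  · by_contra hxP
    exact hSw x hx (hXw x ⟨hx.2, hxP⟩)
  intro m hm1 hmn hmS hvis
  by_contra hmlk
  obtain ⟨t, ht, ht1, htb⟩ := exists_scale_mem_ball (u 0) (u m) hr
  refine hSw _ ⟨hSs _ hmS t ht, htb⟩ ?_
  rw [← hout m hm1 hmn hmlk]
  refine (convex_segment (u 0 + t • (u m - u 0)) (u m)).isPreconnected.totalAngle_eq hlk ?_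
    (left_mem_segment ℝ _ _) (right_mem_segment ℝ _ _)
  rintro x ⟨α, β, hα, hβ, hαβ, rfl⟩
  obtain rfl : β = 1 - α := by linarith
  have hτ0 : 0 < α * t + (1 - α) := by nlinarith
  have hxe : α • (u 0 + t • (u m - u 0)) + (1 - α) • u m
      = u 0 + (α * t + (1 - α)) • (u m - u 0) := by module
  rw [hxe]
  rintro (h | h | ⟨b, hb, hbk, h⟩)
  · have h1 := affine_eq_zero_of_mem_segment _ c.b_O c.b_A h
    rw [c.b_scale] at h1
    exact hp.not_collinear 0 l m (by omega) (by omega) hmn (by omega) (by omega) (by omega)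
      (c.collinear_of_b_eq_zero ((mul_eq_zero.1 h1).resolve_left hτ0.ne'))
  · have h1 := affine_eq_zero_of_mem_segment _ c.a_O c.a_B h
    rw [c.a_scale] at h1
    exact hp.not_collinear 0 k m (by omega) (by omega) hmn (by omega) (by omega) (by omega)
      (c.collinear_of_a_eq_zero ((mul_eq_zero.1 h1).resolve_left hτ0.ne'))
  · have hzb : u m ∈ segment ℝ (u b) (u (b + 1)) := by
      rcases eq_or_ne α 0 with rfl | hα0
      · have : u 0 + ((0 : ℝ) * t + (1 - 0)) • (u m - u 0) = u m := by module
        rwa [this] at h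
      · have hα0 : 0 < α := lt_of_le_of_ne hα hα0.symm
        refine (hp.edge_of_mem_openSegment hm1 hmn (by omega) hvis ?_ h).1
        exact ⟨1 - (α * t + (1 - α)), α * t + (1 - α), by nlinarith, hτ0, by ring, by module⟩
    have := hp.eq_of_vertex_mem_edge hmn (by omega) hzb
    omega

end IndexedPolygon

/-- The open triangle with vertices `O`, `A`, `B`. -/
def AffCoords.triangle {O A B : Plane} (c : AffCoords O A B) : Set Plane :=
  {x | 0 < c.a x ∧ 0 < c.b x ∧ c.a x + c.b x < 1}

theorem AffCoords.mem_closure_triangle_inter {O A B : Plane} (c : AffCoords O A B)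
    (ψ : Plane →ᵃ[ℝ] ℝ) (hne : (c.triangle ∩ {x | ψ x < 0}).Nonempty) {y : Plane}
    (ha : 0 ≤ c.a y) (hb : 0 ≤ c.b y) (hab : c.a y + c.b y ≤ 1) (hψ : ψ y ≤ 0) :
    y ∈ closure (c.triangle ∩ {x | ψ x < 0}) := by
  obtain ⟨g, ⟨h1, h2, h3⟩, h4⟩ := hne
  rw [Set.mem_ofPred_eq] at h4
  refine closure_mono (s := openSegment ℝ y g) ?_
    (segment_subset_closure_openSegment (left_mem_segment ℝ y g))
  rintro x ⟨s, t, hs, ht, hst, rfl⟩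
  simp only [AffCoords.triangle, Set.mem_inter_iff, Set.mem_ofPred_eq, affine_combo _ hst]
  refine ⟨⟨by positivity, by positivity, ?_⟩, ?_⟩ <;> nlinarith

theorem AffCoords.isOpen_triangle {O A B : Plane} (c : AffCoords O A B) : IsOpen c.triangle :=
  (isOpen_lt continuous_const (continuous_affine c.a)).inter
    ((isOpen_lt continuous_const (continuous_affine c.b)).inter
      (isOpen_lt ((continuous_affine c.a).add (continuous_affine c.b)) continuous_const))

theorem AffCoords.convex_triangle {O A B : Plane} (c : AffCoords O A B) : Convex ℝ c.triangle :=
  (convex_affine_pos c.a).inter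
    ((convex_affine_pos c.b).inter ((convex_Iio (1 : ℝ)).affine_preimage (c.a + c.b)))

theorem AffCoords.of_mem_frontier_triangle {O A B : Plane} (c : AffCoords O A B) {x : Plane}
    (hx : x ∈ frontier c.triangle) : 0 ≤ c.a x ∧ 0 ≤ c.b x ∧ c.a x + c.b x ≤ 1 ∧
      (c.a x = 0 ∨ c.b x = 0 ∨ c.a x + c.b x = 1) := by
  have ha := continuous_affine c.a
  have hb := continuous_affine c.b
  have hcl : IsClosed {x | 0 ≤ c.a x ∧ 0 ≤ c.b x ∧ c.a x + c.b x ≤ 1} :=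
    (isClosed_le continuous_const ha).inter
      ((isClosed_le continuous_const hb).inter (isClosed_le (ha.add hb) continuous_const))
  have hsub : c.triangle ⊆ {x | 0 ≤ c.a x ∧ 0 ≤ c.b x ∧ c.a x + c.b x ≤ 1} :=
    fun y hy => ⟨hy.1.le, hy.2.1.le, hy.2.2.le⟩
  obtain ⟨h1, h2, h3⟩ := closure_minimal hsub hcl hx.1
  refine ⟨h1, h2, h3, ?_⟩
  by_contra! hc
  refine hx.2 ?_
  rw [c.isOpen_triangle.interior_eq]
  exact ⟨lt_of_le_of_ne h1 hc.1.symm, lt_of_le_of_ne h2 hc.2.1.symm, lt_of_le_of_ne h3 hc.2.2⟩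

/-- A segment that enters `K ∩ {ψ < 0}` and does not cross the boundary of `K` there has an endpoint
in `K ∩ {ψ < 0}`. -/
theorem exists_endpoint_mem {K : Set Plane} (ψ : Plane →ᵃ[ℝ] ℝ) {p q x : Plane}
    (hx : x ∈ segment ℝ p q) (hxK : x ∈ K) (hψ : ψ x < 0)
    (hfr : ∀ y ∈ segment ℝ p q, ψ y < 0 → y ∉ frontier K) :
    (p ∈ K ∧ ψ p < 0) ∨ (q ∈ K ∧ ψ q < 0) := by
  have key : ∀ w ∈ segment ℝ p q, ψ w ≤ ψ x → w ∈ K ∧ ψ w < 0 := by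
    intro w hw hwx
    refine ⟨?_, hwx.trans_lt hψ⟩
    have hs : ∀ y ∈ segment ℝ x w, y ∉ frontier K := by
      intro y hy
      refine hfr y ((convex_segment p q).segment_subset hx hw hy) ?_
      obtain ⟨s, t, hs, ht, hst, rfl⟩ := hy
      rw [affine_combo _ hst]
      nlinarith
    rcases (convex_segment x w).isPreconnected.subset_interior_or_disjoint hs with h | h
    · exact interior_subset (h (right_mem_segment ℝ x w))
    · exact (h (left_mem_segment ℝ x w) hxK).elim
  rcases le_total (ψ p) (ψ q) with h | h
  · refine Or.inl (key p (left_mem_segment ℝ p q) ?_)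
    obtain ⟨s, t, hs, ht, hst, rfl⟩ := hx
    rw [affine_combo _ hst]
    obtain rfl : s = 1 - t := by linarith
    nlinarith
  · refine Or.inr (key q (right_mem_segment ℝ p q) ?_)
    obtain ⟨s, t, hs, ht, hst, rfl⟩ := hx
    rw [affine_combo _ hst]
    obtain rfl : s = 1 - t := by linarith
    nlinarith

namespace IndexedPolygon

variable {n : ℕ} {u : ℕ → Plane} {P : Set Plane} {l k : ℕ}

theorem mem_of_truncated_triangle (hp : IndexedPolygon n u P) {X Y : Plane}
    (c : AffCoords (u 0) X Y) (ψ : Plane →ᵃ[ℝ] ℝ) (hO : ψ (u 0) ≤ 0)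
    (hne : (c.triangle ∩ {x | ψ x < 0}).Nonempty) {r : ℝ} (hr : 0 < r)
    (hball : c.triangle ∩ Metric.ball (u 0) r ⊆ interior P)
    (hvert : ∀ m, 1 ≤ m → m < n → u m ∈ c.triangle → 0 ≤ ψ (u m))
    (hfr : ∀ x, 0 ≤ c.a x → 0 ≤ c.b x → c.a x + c.b x ≤ 1 →
      (c.a x = 0 ∨ c.b x = 0 ∨ c.a x + c.b x = 1) → ψ x < 0 → ∀ e < n,
      x ∈ segment ℝ (u e) (u (e + 1)) → ∀ y ∈ segment ℝ (u e) (u (e + 1)), y ∉ c.triangle)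
    {y : Plane} (ha : 0 ≤ c.a y) (hb : 0 ≤ c.b y) (hab : c.a y + c.b y ≤ 1) (hψ : ψ y ≤ 0) :
    y ∈ P := by
  have hOt : u 0 ∉ c.triangle := fun h => by
    have := h.1
    rw [c.a_O] at this
    exact this.false
  have hvert' : ∀ m, m < n → ¬ (u m ∈ c.triangle ∧ ψ (u m) < 0) := by
    rintro m hm ⟨h1, h2⟩
    rcases Nat.eq_zero_or_pos m with rfl | hm0
    · exact hOt h1
    · exact (hvert m hm0 hm h1).not_gt h2
  have hoff : ∀ x ∈ c.triangle ∩ {x | ψ x < 0}, x ∉ frontier P := by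
    rintro x ⟨hxK, hxψ⟩ hxf
    obtain ⟨e, he, hxe⟩ := (hp.mem_frontier x).1 hxf
    rcases exists_endpoint_mem ψ hxe hxK hxψ (fun z hz hzψ hzf => by
      obtain ⟨h1, h2, h3, h4⟩ := c.of_mem_frontier_triangle hzf
      exact hfr z h1 h2 h3 h4 hzψ e he hz x hxe hxK) with h | h
    · exact hvert' e he h
    · obtain ⟨e', he', -, hue, -⟩ := hp.exists_next he
      rw [hue] at h
      exact hvert' e' he' h
  have hsub : c.triangle ∩ {x | ψ x < 0} ⊆ interior P := by
    refine ((c.convex_triangle.inter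
      (convex_affine_neg ψ)).isPreconnected.subset_interior_or_disjoint hoff).resolve_right ?_
    intro hdis
    obtain ⟨g, ⟨h1, h2, h3⟩, h4⟩ := hne
    rw [Set.mem_ofPred_eq] at h4
    obtain ⟨t, ht, ht1, htb⟩ := exists_scale_mem_ball (u 0) g hr
    have hgt : u 0 + t • (g - u 0) ∈ c.triangle := by
      refine ⟨?_, ?_, ?_⟩
      · rw [c.a_scale]; positivity
      · rw [c.b_scale]; positivity
      · rw [c.a_scale, c.b_scale]; nlinarith
    refine hdis ⟨hgt, ?_⟩ (interior_subset (hball ⟨hgt, htb⟩))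
    rw [Set.mem_ofPred_eq, affine_add_smul_sub]
    nlinarith
  exact closure_minimal (hsub.trans interior_subset) hp.compact.isClosed
    (c.mem_closure_triangle_inter ψ hne ha hb hab hψ)

end IndexedPolygon

theorem exists_first_mem_frontier {P : Set Plane} (hP : IsCompact P) {O w : Plane} (hw : w ≠ 0)
    (h : ∀ᶠ t in nhdsWithin (0 : ℝ) (Set.Ioi 0), O + t • w ∈ interior P) :
    ∃ t₀ : ℝ, 0 < t₀ ∧ O + t₀ • w ∈ frontier P ∧
      ∀ t, 0 < t → t < t₀ → O + t • w ∉ frontier P := by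
  obtain ⟨ε, hε, hεP⟩ := mem_nhdsGT_iff_exists_Ioo_subset.1 h
  have hε : 0 < ε := hε
  have hcont : Continuous fun t : ℝ => O + t • w := by fun_prop
  set T : Set ℝ := Set.Ici ε ∩ (fun t : ℝ => O + t • w) ⁻¹' frontier P with hT
  have hTcl : IsClosed T := isClosed_Ici.inter (isClosed_frontier.preimage hcont)
  have hfr : ∀ t, 0 < t → O + t • w ∈ frontier P → t ∈ T := by
    intro t ht htf
    refine ⟨?_, htf⟩
    by_contra hlt
    exact htf.2 (hεP ⟨ht, not_le.1 hlt⟩)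
  have hTne : T.Nonempty := by
    by_contra hemp
    have hoff : ∀ x ∈ (fun t : ℝ => O + t • w) '' Set.Ioi 0, x ∉ frontier P := by
      rintro _ ⟨t, ht, rfl⟩ htf
      exact hemp ⟨t, hfr t ht htf⟩
    have hpre := (isPreconnected_Ioi (a := (0 : ℝ))).image _ hcont.continuousOn
    rcases hpre.subset_interior_or_disjoint hoff with hs | hs
    · obtain ⟨R, hR⟩ := hP.isBounded.exists_norm_le
      have hw' : 0 < ‖w‖ := norm_pos_iff.2 hw
      have hRO : 0 ≤ |R| + ‖O‖ := by positivity
      set t : ℝ := (|R| + ‖O‖ + 1) / ‖w‖ with ht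
      have ht0 : 0 < t := by positivity
      have h1 := hR _ (interior_subset (hs ⟨t, ht0, rfl⟩))
      have h2 : ‖t • w‖ = |R| + ‖O‖ + 1 := by
        rw [norm_smul, Real.norm_of_nonneg ht0.le, ht, div_mul_cancel₀ _ hw'.ne']
      have h3 : ‖t • w‖ ≤ ‖O + t • w‖ + ‖O‖ := by
        simpa using norm_sub_le (O + t • w) O
      have := le_abs_self R
      simp only at h1
      linarith
    · exact hs ⟨ε / 2, half_pos hε, rfl⟩
        (interior_subset (hεP ⟨half_pos hε, half_lt_self hε⟩))
  have hTbdd : BddBelow T := ⟨ε, fun t ht => ht.1⟩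
  have hmem := hTcl.csInf_mem hTne hTbdd
  exact ⟨sInf T, hε.trans_le hmem.1, hmem.2, fun t ht htlt htf =>
    htlt.not_ge (csInf_le hTbdd (hfr t ht htf))⟩

theorem not_collinear_of_affine (f : Plane →ᵃ[ℝ] ℝ) {O q p : Plane} (hO : f O = 0) (hq : f q = 0)
    (hqO : q ≠ O) (hp : f p ≠ 0) : ¬ Collinear ℝ ({O, q, p} : Set Plane) := by
  intro h
  obtain ⟨v, hv⟩ := (collinear_iff_of_mem (p₀ := O) (by simp)).1 h
  obtain ⟨r₁, h₁⟩ := hv q (by simp)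
  obtain ⟨r₂, h₂⟩ := hv p (by simp)
  have key : ∀ r : ℝ, f (r • v +ᵥ O) = r * f (v + O) := by
    intro r
    have := affine_add_smul_sub f O (v + O) O r
    rw [hO, add_sub_cancel_right] at this
    rw [vadd_eq_add, add_comm, this]
    ring
  rw [h₁, key] at hq
  rw [h₂, key] at hp
  rcases mul_eq_zero.1 hq with h0 | h0
  · exact hqO (by rw [h₁, h0]; simp)
  · exact hp (by rw [h0, mul_zero])

theorem AffCoords.apply_eq {O A B : Plane} (c : AffCoords O A B) (f : Plane →ᵃ[ℝ] ℝ)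
    (hf : f O = 0) (x : Plane) : f x = c.a x * f A + c.b x * f B := by
  conv_lhs => rw [c.eq x]
  rw [← add_assoc, affine_add_smul_sub, affine_add_smul_sub, hf]
  ring

namespace IndexedPolygon

variable {n : ℕ} {u : ℕ → Plane} {P : Set Plane} {l k : ℕ}

theorem mem_of_inner_of_le (hp : IndexedPolygon n u P) (hl : 1 ≤ l) (hln : l < n) (hk : 1 ≤ k)
    (hkn : k < n) (hA : segment ℝ (u 0) (u l) ⊆ P) (hB : segment ℝ (u 0) (u k) ⊆ P)
    (c : AffCoords (u 0) (u l) (u k)) {r : ℝ} (hr : 0 < r)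
    (hball : c.inner ∩ Metric.ball (u 0) r ⊆ interior P) {h₀ : ℝ} (h0 : 0 < h₀) (h1 : h₀ ≤ 1)
    (hvert : ∀ m, 1 ≤ m → m < n → u m ∈ c.triangle → h₀ ≤ c.a (u m) + c.b (u m))
    {y : Plane} (ha : 0 ≤ c.a y) (hb : 0 ≤ c.b y) (hab : c.a y + c.b y ≤ h₀) : y ∈ P := by
  set ψ : Plane →ᵃ[ℝ] ℝ := c.a + c.b - AffineMap.const ℝ Plane h₀ with hψdef
  have hψ : ∀ x, ψ x = c.a x + c.b x - h₀ := fun x => by simp [hψdef]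
  have htri : c.triangle ⊆ c.inner := fun x hx => ⟨hx.1, hx.2.1⟩
  refine hp.mem_of_truncated_triangle c ψ ?_ ?_ hr
    ((Set.inter_subset_inter_left _ htri).trans hball) ?_ ?_ ha hb (by linarith)
    (by rw [hψ]; linarith)
  · rw [hψ, c.a_O, c.b_O]; linarith
  · refine ⟨u 0 + (h₀ / 4) • (u l - u 0) + (h₀ / 4) • (u k - u 0), ?_⟩
    simp only [AffCoords.triangle, Set.mem_inter_iff, Set.mem_ofPred_eq, hψ, affine_add_smul_sub,
      c.a_O, c.a_A, c.a_B, c.b_O, c.b_A, c.b_B]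
    refine ⟨⟨?_, ?_, ?_⟩, ?_⟩ <;> linarith
  · intro m hm hmn hmt
    rw [hψ]
    linarith [hvert m hm hmn hmt]
  · intro x hxa hxb _ hcase hxψ e he hxe y hye hyt
    rw [hψ] at hxψ
    have hseg := c.eq x
    rcases eq_or_ne (c.a x) 0 with ha0 | ha0
    · rcases eq_or_ne (c.b x) 0 with hb0 | hb0
      · rw [ha0, hb0, zero_smul, zero_smul, add_zero, add_zero] at hseg
        rw [hseg] at hxe
        obtain ⟨t, ht, ht1, htb⟩ := exists_scale_mem_ball (u 0) y hr
        have hte : u 0 + t • (y - u 0) ∈ segment ℝ (u e) (u (e + 1)) :=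
          (convex_segment _ _).segment_subset hxe hye
            ⟨1 - t, t, by linarith, ht.le, by ring, by module⟩
        exact ((hp.mem_frontier _).2 ⟨e, he, hte⟩).2
          (hball ⟨c.inner_scale (htri hyt) ht, htb⟩)
      · have hop : x ∈ openSegment ℝ (u 0) (u k) := by
          refine ⟨1 - c.b x, c.b x, by linarith, lt_of_le_of_ne hxb hb0.symm, by ring, ?_⟩
          conv_rhs => rw [hseg, ha0]
          module
        have := affine_eq_zero_of_mem_segment c.a c.a_O c.a_B
          ((hp.edge_of_mem_openSegment hk hkn he hB hop hxe).2 hye)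
        exact hyt.1.ne' this
    · have hb0 : c.b x = 0 := by
        rcases hcase with h | h | h
        · exact (ha0 h).elim
        · exact h
        · linarith
      have hop : x ∈ openSegment ℝ (u 0) (u l) := by
        refine ⟨1 - c.a x, c.a x, by linarith, lt_of_le_of_ne hxa ha0.symm, by ring, ?_⟩
        conv_rhs => rw [hseg, hb0]
        module
      have := affine_eq_zero_of_mem_segment c.b c.b_O c.b_A
        ((hp.edge_of_mem_openSegment hl hln he hA hop hxe).2 hye)
      exact hyt.2.1.ne' this

/-- If no vertex in the cone spanned by two diagonals or edges at `u 0` is visible, then the closed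
triangle that they span lies in the polygon. -/
theorem mem_of_inner (hp : IndexedPolygon n u P) (hl : 1 ≤ l) (hln : l < n) (hk : 1 ≤ k)
    (hkn : k < n) (hA : segment ℝ (u 0) (u l) ⊆ P) (hB : segment ℝ (u 0) (u k) ⊆ P)
    (c : AffCoords (u 0) (u l) (u k)) {r : ℝ} (hr : 0 < r)
    (hball : c.inner ∩ Metric.ball (u 0) r ⊆ interior P)
    (hvis : ∀ m, 1 ≤ m → m < n → u m ∈ c.inner → ¬ segment ℝ (u 0) (u m) ⊆ P)
    {y : Plane} (ha : 0 ≤ c.a y) (hb : 0 ≤ c.b y) (hab : c.a y + c.b y ≤ 1) : y ∈ P := by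
  classical
  refine hp.mem_of_inner_of_le hl hln hk hkn hA hB c hr hball one_pos le_rfl ?_ ha hb hab
  intro m₀ hm₀ hm₀n hm₀t
  exfalso
  obtain ⟨m, hmem, hmin⟩ := ((Finset.range n).filter
    fun m => 1 ≤ m ∧ u m ∈ c.triangle).exists_min_image (fun m => c.a (u m) + c.b (u m))
    ⟨m₀, by simp [hm₀, hm₀n, hm₀t]⟩
  simp only [Finset.mem_filter, Finset.mem_range] at hmem hmin
  obtain ⟨hmn, hm1, hmt⟩ := hmem
  obtain ⟨h1, h2, h3⟩ := hmt
  refine hvis m hm1 hmn ⟨h1, h2⟩ ?_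
  rintro x ⟨s, t, hs, ht, hst, rfl⟩
  refine hp.mem_of_inner_of_le hl hln hk hkn hA hB c hr hball (add_pos h1 h2) h3.le
    (fun m' h1' h2' h3' => hmin m' ⟨h2', h1', h3'⟩) ?_ ?_ ?_ <;>
    simp only [affine_combo _ hst, c.a_O, c.b_O]
  · nlinarith
  · nlinarith
  · nlinarith

theorem a_nonneg_of_b_eq_zero (hp : IndexedPolygon n u P) (hl : 1 ≤ l) (hln : l < n)
    (c : AffCoords (u 0) (u l) (u k)) {m : ℕ} (hm : m < n) (hbm : c.b (u m) = 0) :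
    0 ≤ c.a (u m) := by
  rcases eq_or_ne m 0 with rfl | hm0
  · exact c.a_O.ge
  rcases eq_or_ne m l with rfl | hml
  · rw [c.a_A]; exact zero_le_one
  · exact (hp.not_collinear 0 l m (by omega) hln hm (by omega) (by omega) (by omega)
      (c.collinear_of_b_eq_zero hbm)).elim

theorem exists_endpoint_neg (hp : IndexedPolygon n u P) (hl : 1 ≤ l) (hln : l < n)
    (c : AffCoords (u 0) (u l) (u k)) {q : Plane} (hqa : c.a q < 0) (hqb : c.b q = 0) {e : ℕ}
    (he : e < n) (hqe : q ∈ segment ℝ (u e) (u (e + 1))) :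
    ∃ m p, 1 ≤ m ∧ m < n ∧ segment ℝ (u e) (u (e + 1)) = segment ℝ (u m) p ∧
      c.b (u m) < 0 := by
  have hne0 : ∀ m, c.b (u m) < 0 → 1 ≤ m := by
    intro m hm
    by_contra hm0
    obtain rfl : m = 0 := by omega
    exact hm.ne c.b_O
  obtain ⟨e', he', -, hue, -⟩ := hp.exists_next he
  rcases lt_or_ge (c.b (u e)) 0 with h1 | h1
  · exact ⟨e, _, hne0 e h1, he, rfl, h1⟩
  rcases lt_or_ge (c.b (u e')) 0 with h2 | h2
  · exact ⟨e', u e, hne0 e' h2, he', by rw [hue, segment_symm], h2⟩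
  exfalso
  rw [hue] at hqe
  obtain ⟨s, t, hs, ht, hst, rfl⟩ := hqe
  rw [affine_combo _ hst] at hqa hqb
  have h3 := mul_nonneg hs h1
  have h4 := mul_nonneg ht h2
  have h5 : s * c.b (u e) = 0 := by linarith
  have h6 : t * c.b (u e') = 0 := by linarith
  have h7 : 0 ≤ s * c.a (u e) := by
    rcases mul_eq_zero.1 h5 with h | h
    · rw [h, zero_mul]
    · exact mul_nonneg hs (hp.a_nonneg_of_b_eq_zero hl hln c he h)
  have h8 : 0 ≤ t * c.a (u e') := by
    rcases mul_eq_zero.1 h6 with h | h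
    · rw [h, zero_mul]
    · exact mul_nonneg ht (hp.a_nonneg_of_b_eq_zero hl hln c he' h)
  linarith

/-- If the complement of a cone at `u 0` spanned by two vertices starts in the interior of the
polygon, then it contains a visible vertex. -/
theorem exists_visible_mem_outer (hp : IndexedPolygon n u P) (hl : 1 ≤ l) (hln : l < n)
    (c : AffCoords (u 0) (u l) (u k)) {r : ℝ} (hr : 0 < r)
    (hball : c.outer ∩ Metric.ball (u 0) r ⊆ interior P) :
    ∃ m, 1 ≤ m ∧ m < n ∧ u m ∈ c.outer ∧ segment ℝ (u 0) (u m) ⊆ P := by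
  classical
  have hw : u 0 - u l ≠ 0 := sub_ne_zero.2 (hp.ne (by omega) hln (by omega))
  have haw : ∀ t : ℝ, c.a (u 0 + t • (u 0 - u l)) = -t := fun t => by
    rw [affine_add_smul_sub, c.a_O, c.a_A]; ring
  have hbw : ∀ t : ℝ, c.b (u 0 + t • (u 0 - u l)) = 0 := fun t => by
    rw [affine_add_smul_sub, c.b_O, c.b_A]; ring
  obtain ⟨t₀, ht₀, hqf, hfirst⟩ := exists_first_mem_frontier hp.compact (O := u 0) hw (by
    filter_upwards [eventually_mem_ball (Metric.mem_ball_self hr) (u 0 - u l),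
      self_mem_nhdsWithin] with t h1 h2
    have h2 : 0 < t := h2
    exact hball ⟨Or.inl (by rw [haw]; linarith), h1⟩)
  set q := u 0 + t₀ • (u 0 - u l) with hq
  have hqa : c.a q < 0 := by rw [haw]; linarith
  have hqb : c.b q = 0 := hbw t₀
  obtain ⟨e, he, hqe⟩ := (hp.mem_frontier q).1 hqf
  obtain ⟨m₀, p₂, hm₀, hm₀n, hseg, hneg⟩ := hp.exists_endpoint_neg hl hln c hqa hqb he hqe
  have hqO : q ≠ u 0 := fun h => by rw [h, c.a_O] at hqa; exact hqa.false
  obtain ⟨d⟩ := exists_affCoords (not_collinear_of_affine c.b c.b_O hqb hqO hneg.ne)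
  have hbd : ∀ x, c.b x = d.b x * c.b (u m₀) := fun x => by
    rw [d.apply_eq c.b c.b_O x, hqb]; ring
  have hout : ∀ x, 0 < d.b x → x ∈ c.outer := fun x hx =>
    Or.inr (by rw [hbd]; exact mul_neg_of_pos_of_neg hx hneg)
  have hedge : ∀ x ∈ segment ℝ (u e) (u (e + 1)), d.a x + d.b x = 1 := by
    intro x hx
    set f : Plane →ᵃ[ℝ] ℝ := d.a + d.b - AffineMap.const ℝ Plane 1 with hfdef
    have hf : ∀ x, f x = d.a x + d.b x - 1 := fun x => by simp [hfdef]
    have hfm : f (u m₀) = 0 := by rw [hf, d.a_B, d.b_B]; ring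
    have hfp : f p₂ = 0 := by
      have hfq : f q = 0 := by rw [hf, d.a_A, d.b_A]; ring
      rw [hseg] at hqe
      obtain ⟨s, t, hs, ht, hst, hstq⟩ := hqe
      rw [← hstq, affine_combo _ hst, hfm, mul_zero, zero_add] at hfq
      refine (mul_eq_zero.1 hfq).resolve_left ?_
      rintro rfl
      obtain rfl : s = 1 := by linarith
      rw [one_smul, zero_smul, add_zero] at hstq
      rw [← hstq] at hqb
      exact hneg.ne hqb
    rw [hseg] at hx
    have := affine_eq_zero_of_mem_segment f hfm hfp hx
    rw [hf] at this
    linarith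
  obtain ⟨m, hmem, hmin⟩ := ((Finset.range n).filter
    fun m => 1 ≤ m ∧ 0 ≤ d.a (u m) ∧ 0 < d.b (u m) ∧ d.a (u m) + d.b (u m) ≤ 1).exists_min_image
    (fun m => d.b (u m) / (d.a (u m) + d.b (u m)))
    ⟨m₀, by simp [hm₀, hm₀n, d.a_B, d.b_B]⟩
  simp only [Finset.mem_filter, Finset.mem_range] at hmem hmin
  obtain ⟨hmn, hm1, hma, hmb, hmab⟩ := hmem
  have hmpos : 0 < d.a (u m) + d.b (u m) := by linarith
  set σ := d.b (u m) / (d.a (u m) + d.b (u m)) with hσ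
  have hσ0 : 0 < σ := div_pos hmb hmpos
  have hσ1 : σ ≤ 1 := (div_le_one hmpos).2 (by linarith)
  set ψ : Plane →ᵃ[ℝ] ℝ := d.b - σ • (d.a + d.b) with hψdef
  have hψ : ∀ x, ψ x = d.b x - σ * (d.a x + d.b x) := fun x => by simp [hψdef, mul_add]
  have hψm : ψ (u m) = 0 := by rw [hψ, hσ, div_mul_cancel₀ _ hmpos.ne', sub_self]
  have hψO : ψ (u 0) = 0 := by rw [hψ, d.a_O, d.b_O]; ring
  have hvert : ∀ m', 1 ≤ m' → m' < n → 0 ≤ d.a (u m') → 0 < d.b (u m') →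
      d.a (u m') + d.b (u m') ≤ 1 → 0 ≤ ψ (u m') := by
    intro m' h1 h2 h3 h4 h5
    have := (le_div_iff₀ (by linarith)).1 (hmin m' ⟨h2, h1, h3, h4, h5⟩)
    rw [hψ]
    linarith
  refine ⟨m, hm1, hmn, hout _ hmb, ?_⟩
  rintro y ⟨s, t, hs, ht, hst, rfl⟩
  refine hp.mem_of_truncated_triangle d ψ hψO.le ?_ hr ?_
    (fun m' h1 h2 h3 => hvert m' h1 h2 h3.1.le h3.2.1 h3.2.2.le) ?_ ?_ ?_ ?_ ?_
  · refine ⟨u 0 + (1 / 2 : ℝ) • (q - u 0) + (σ / 4) • (u m₀ - u 0), ?_⟩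
    simp only [AffCoords.triangle, Set.mem_inter_iff, Set.mem_ofPred_eq, hψ, affine_add_smul_sub,
      d.a_O, d.a_A, d.a_B, d.b_O, d.b_A, d.b_B]
    refine ⟨⟨?_, ?_, ?_⟩, ?_⟩ <;> nlinarith
  · exact fun x hx => hball ⟨hout x hx.1.2.1, hx.2⟩
  · intro x hxa hxb hxab hcase hxψ e₁ he₁ hxe₁ y hye₁ hyt
    have hxψ' := hxψ
    rw [hψ] at hxψ
    have ha0 : 0 < d.a x := by
      refine lt_of_le_of_ne hxa fun h => ?_
      rw [← h] at hxψ
      nlinarith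
    have hx1 : d.a x + d.b x = 1 := by
      by_contra hx1
      have hb0 : d.b x = 0 := by
        rcases hcase with h | h | h
        · exact (ha0.ne' h).elim
        · exact h
        · exact (hx1 h).elim
      have hlt : d.a x < 1 := lt_of_le_of_ne (by linarith) (by rwa [hb0, add_zero] at hx1)
      refine hfirst (d.a x * t₀) (by positivity) (by nlinarith) ?_
      have : u 0 + (d.a x * t₀) • (u 0 - u l) = x := by
        conv_rhs => rw [d.eq x, hb0]
        rw [mul_smul, ← add_sub_cancel_left (u 0) (t₀ • (u 0 - u l)), ← hq, zero_smul, add_zero]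
      rw [this]
      exact (hp.mem_frontier x).2 ⟨e₁, he₁, hxe₁⟩
    have hxe : x ∈ segment ℝ (u e) (u (e + 1)) := by
      refine (convex_segment _ _).segment_subset hqe
        (hseg ▸ left_mem_segment ℝ (u m₀) p₂)
        ⟨d.a x, d.b x, hxa, hxb, hx1, ?_⟩
      conv_rhs => rw [d.eq x]
      obtain h : d.a x = 1 - d.b x := by linarith
      rw [h]
      module
    rcases eq_or_ne e e₁ with rfl | hne
    · have := hedge y hye₁
      exact hyt.2.2.ne this
    · obtain ⟨m', hm', hxm⟩ := hp.inter e e₁ he he₁ hne x hxe hxe₁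
      rw [hxm] at hxψ' hx1 hxb hxa
      rcases eq_or_ne (d.b (u m')) 0 with hb0 | hb0
      · have h1 := d.apply_eq c.a c.a_O (u m')
        have h2 := hp.a_nonneg_of_b_eq_zero hl hln c hm' (by rw [hbd, hb0, zero_mul])
        rw [hb0, add_zero] at hx1
        rw [hb0, hx1] at h1
        linarith
      · refine (hvert m' ?_ hm' hxa (lt_of_le_of_ne hxb hb0.symm) hx1.le).not_gt hxψ'
        rcases Nat.eq_zero_or_pos m' with rfl | h
        · exact (hb0 d.b_O).elim
        · exact h
  all_goals simp only [affine_combo _ hst, d.a_O, d.b_O, hψO, hψm]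
  · nlinarith
  · nlinarith
  · nlinarith
  · simp

/-- The closed triangle spanned by `u 0` and two vertices visible from it lies in the polygon if no
vertex strictly between them is visible from `u 0`. -/
theorem convexHull_subset (hp : IndexedPolygon n u P) (hl : 1 ≤ l) (hlk : l < k) (hkn : k < n)
    (hA : segment ℝ (u 0) (u l) ⊆ P) (hB : segment ℝ (u 0) (u k) ⊆ P)
    (hvis : ∀ m, l < m → m < k → ¬ segment ℝ (u 0) (u m) ⊆ P) :
    convexHull ℝ {u 0, u l, u k} ⊆ P := by
  obtain ⟨c⟩ := exists_affCoords (hp.not_collinear 0 l k (by omega) (by omega) hkn (by omega)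
    (by omega) (by omega))
  obtain ⟨r, hr, S, hS, hball, hSvis⟩ := hp.exists_sector hl hlk hkn hA hB c
  have hSl : u l ∉ S ∧ u k ∉ S := by
    rcases hS with rfl | rfl <;>
      simp [AffCoords.inner, AffCoords.outer, c.a_A, c.b_A, c.a_B, c.b_B, zero_le_one]
  have hnone : ∀ m, 1 ≤ m → m < n → u m ∈ S → ¬ segment ℝ (u 0) (u m) ⊆ P := by
    intro m h1 h2 h3 h4
    obtain ⟨h5, h6⟩ := hSvis m h1 h2 h3 h4
    rcases eq_or_ne m l with rfl | hml
    · exact hSl.1 h3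
    rcases eq_or_ne m k with rfl | hmk
    · exact hSl.2 h3
    · exact hvis m (by omega) (by omega) h4
  rcases hS with rfl | rfl
  · have hconv : Convex ℝ {y | 0 ≤ c.a y ∧ 0 ≤ c.b y ∧ c.a y + c.b y ≤ 1} :=
      ((convex_Ici (0 : ℝ)).affine_preimage c.a).inter
        (((convex_Ici (0 : ℝ)).affine_preimage c.b).inter
          ((convex_Iic (1 : ℝ)).affine_preimage (c.a + c.b)))
    intro y hy
    obtain ⟨h1, h2, h3⟩ := convexHull_min (by
      rintro x (rfl | rfl | rfl) <;>
        simp [c.a_O, c.b_O, c.a_A, c.b_A, c.a_B, c.b_B]) hconv hy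
    exact hp.mem_of_inner hl (by omega) (by omega) hkn hA hB c hr hball hnone h1 h2 h3
  · obtain ⟨m, h1, h2, h3, h4⟩ := hp.exists_visible_mem_outer hl (by omega) c hr hball
    exact (hnone m h1 h2 h3 h4).elim

end IndexedPolygon

namespace SimplePolygon

/-- The vertices of a simple polygon, listed along the natural numbers from the vertex `i` on. -/
theorem indexedPolygon {n : ℕ} (SP : SimplePolygon n) (i : ZMod n) :
    IndexedPolygon n (fun t => SP.v (i + (t : ZMod n))) SP.P := by
  have h3 := SP.three_le
  have : NeZero n := ⟨by omega⟩
  have hcast : ∀ a b, a < n → b < n → a ≠ b → i + (a : ZMod n) ≠ i + (b : ZMod n) := by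
    intro a b ha hb hab h
    have h := congrArg ZMod.val (add_left_cancel h)
    rw [ZMod.val_natCast_of_lt ha, ZMod.val_natCast_of_lt hb] at h
    exact hab h
  have hindex : ∀ j : ZMod n, ∃ a < n, j = i + (a : ZMod n) := fun j =>
    ⟨(j - i).val, ZMod.val_lt _, by rw [ZMod.natCast_zmod_val, add_sub_cancel]⟩
  have hsucc : ∀ a : ℕ, i + ((a + 1 : ℕ) : ZMod n) = i + (a : ZMod n) + 1 := fun a => by
    rw [Nat.cast_succ, add_assoc]
  refine ⟨h3, SP.compact, SP.regular.subset, fun x => ?_, ?_, ?_, ?_⟩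
  · simp only [hsucc]
    rw [SP.frontier_eq, Set.mem_iUnion]
    constructor
    · rintro ⟨j, hj⟩
      obtain ⟨a, ha, rfl⟩ := hindex j
      exact ⟨a, ha, hj⟩
    · rintro ⟨a, -, hx⟩
      exact ⟨_, hx⟩
  · simp
  · intro a b ha hb hab x hxa hxb
    simp only [hsucc] at hxa hxb ⊢
    have hmem : ∀ j, x = SP.v j → ∃ m < n, x = SP.v (i + (m : ZMod n)) := by
      rintro j rfl
      obtain ⟨m, hm, rfl⟩ := hindex j
      exact ⟨m, hm, rfl⟩
    by_cases h1 : i + (b : ZMod n) = i + (a : ZMod n) + 1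
    · rw [h1] at hxb
      exact hmem _ ((SP.edges_consecutive _).subset ⟨hxa, hxb⟩)
    by_cases h2 : i + (a : ZMod n) = i + (b : ZMod n) + 1
    · rw [h2] at hxa
      exact hmem _ ((SP.edges_consecutive _).subset ⟨hxb, hxa⟩)
    · exact (Set.disjoint_left.1 (SP.edges_disjoint _ _ (hcast a b ha hb hab) h1 h2) hxa hxb).elim
  · intro a b c ha hb hc hab hac hbc
    exact SP.no_three_collinear _ _ _ (hcast a b ha hb hab) (hcast a c ha hc hac)
      (hcast b c hb hc hbc)

end SimplePolygon

/-- Lemma 2: let `j = i + k` with `2 ≤ k ≤ n - 1`, and let `t*` be the largest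
`t ∈ {1, …, k-1}` such that `v (i+t)` is visible to `v i`, so that `v' = v (i+t*)` is the
last vertex of the chain `ch(v (i+1), v (j-1))` visible to `v i`. Then `v i` is visible to
`v j` iff `v'` is a triangle witness for `(v i, v j)`: `v'` is visible to `v j` and the
solid triangle `conv {v i, v', v j}` is contained in `P`. -/
theorem visible_iff_last_visible_is_triangle_witness {n : ℕ} (SP : SimplePolygon n)
    (i : ZMod n) (k : ℕ) (hk2 : 2 ≤ k) (hkn : k ≤ n - 1)
    (tstar : ℕ) (ht1 : 1 ≤ tstar) (ht2 : tstar ≤ k - 1)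
    (htvis : Visible SP.P (SP.v (i + (tstar : ZMod n))) (SP.v i))
    (htmax : ∀ t : ℕ, 1 ≤ t → t ≤ k - 1 →
      Visible SP.P (SP.v (i + (t : ZMod n))) (SP.v i) → t ≤ tstar) :
    Visible SP.P (SP.v i) (SP.v (i + (k : ZMod n))) ↔
      (Visible SP.P (SP.v (i + (tstar : ZMod n))) (SP.v (i + (k : ZMod n))) ∧
        convexHull ℝ
          ({SP.v i, SP.v (i + (tstar : ZMod n)), SP.v (i + (k : ZMod n))} : Set Plane)
          ⊆ SP.P) := by
  have hn := SP.three_le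
  have hp := SP.indexedPolygon i
  constructor
  · intro hB
    have hsub : convexHull ℝ
        ({SP.v i, SP.v (i + (tstar : ZMod n)), SP.v (i + (k : ZMod n))} : Set Plane) ⊆ SP.P := by
      have := hp.convexHull_subset (l := tstar) (k := k) ht1 (by omega) (by omega)
        (by simpa [segment_symm, Visible] using htvis) (by simpa [Visible] using hB)
        (fun m h1 h2 h3 => by
          have := htmax m (by omega) (by omega)
            (by simpa [segment_symm, Visible] using h3)
          omega)
      simpa using this
    exact ⟨((convex_convexHull ℝ _).segment_subset (subset_convexHull ℝ _ (by simp))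
      (subset_convexHull ℝ _ (by simp))).trans hsub, hsub⟩
  · rintro ⟨-, hsub⟩
    exact ((convex_convexHull ℝ _).segment_subset (subset_convexHull ℝ _ (by simp))
      (subset_convexHull ℝ _ (by simp))).trans hsub
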